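/- There exist sequences of reals (B_k)_{k≥2} and (B̄_k)_{k≥2} with lim_{k→∞} B_k/ln k = −1/(2 ln 2) and lim_{k→∞} B̄_k/ln k = −1/(2 ln 2) such that for all integers k ≥ 2 and p ≥ 1: (i) with m = 2^p·k − 1, H(m,m) ≥ (m+1)·ln(m+1)/(2 ln 2) + B_k·(m+1) + 1; and (ii) with m = 2^p·(k+1) − 2, H(m,m) ≥ (m+2)·ln(m+2)/(2 ln 2) + B̄_k·(m+2) + 1. -/

import Mathlib

open Filter Polynomial

/-- `Γ` is a periodic orbit of the planar vector field `V`: the image of a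
nonconstant periodic solution of `γ' = V ∘ γ`. -/
def IsPeriodicOrbit (V : ℝ × ℝ → ℝ × ℝ) (Γ : Set (ℝ × ℝ)) : Prop :=
  ∃ γ : ℝ → ℝ × ℝ,
    (∀ t : ℝ, HasDerivAt γ (V (γ t)) t) ∧
    (∃ T : ℝ, 0 < T ∧ Function.Periodic γ T) ∧
    (∃ t₁ t₂ : ℝ, γ t₁ ≠ γ t₂) ∧
    Γ = Set.range γ

/-- `Γ` is a limit cycle of `V`: a periodic orbit which is isolated among
periodic orbits. -/
def IsLimitCycle (V : ℝ × ℝ → ℝ × ℝ) (Γ : Set (ℝ × ℝ)) : Prop :=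
  IsPeriodicOrbit V Γ ∧
  ∃ U : Set (ℝ × ℝ), IsOpen U ∧ Γ ⊆ U ∧
    ∀ Γ' : Set (ℝ × ℝ), IsPeriodicOrbit V Γ' → Γ' ⊆ U → Γ' = Γ

/-- The Liénard vector field `ẋ = y, ẏ = -g(x) - ε f(x) y`. -/
def lienard (f g : Polynomial ℝ) (ε : ℝ) : ℝ × ℝ → ℝ × ℝ :=
  fun p => (p.2, -(g.eval p.1) - ε * (f.eval p.1) * p.2)

/-- `HGe n m c` formalizes `H(n,m) ≥ c`: there are polynomials `f, g` with
`deg f ≤ n`, `deg g ≤ m` and `ε₀ > 0` such that for every `0 < ε ≤ ε₀` the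
Liénard system has at least `c` pairwise distinct limit cycles. -/
def HGe (n m : ℕ) (c : ℝ) : Prop :=
  ∃ f g : Polynomial ℝ, f.natDegree ≤ n ∧ g.natDegree ≤ m ∧
    ∃ ε₀ : ℝ, 0 < ε₀ ∧ ∀ ε : ℝ, 0 < ε → ε ≤ ε₀ →
      ∃ S : Finset (Set (ℝ × ℝ)),
        (∀ Γ ∈ S, IsLimitCycle (lienard f g ε) Γ) ∧ c ≤ (S.card : ℝ)

section

open Set MeasureTheory Topology

theorem continuousOn_intervalIntegral {X : Type*} [TopologicalSpace X] {s : Set X}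
    {F : X → ℝ → ℝ} (hF : ContinuousOn (Function.uncurry F) (s ×ˢ univ)) (a b : ℝ) :
    ContinuousOn (fun x => ∫ θ in a..b, F x θ) s := by
  rw [continuousOn_iff_continuous_domRestrict]
  refine intervalIntegral.continuous_parametric_intervalIntegral_of_continuous'
    (f := fun (x : s) θ => F x θ) ?_ a b
  exact hF.comp_continuous (f := fun p : s × ℝ => ((p.1 : X), p.2)) (by fun_prop)
    (fun p => ⟨p.1.2, mem_univ _⟩)

theorem hasDerivAt_intervalIntegral_param {U : Set ℝ} (hU : IsOpen U) {F F' : ℝ → ℝ → ℝ}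
    (hF : ContinuousOn (Function.uncurry F) (U ×ˢ univ))
    (hF' : ContinuousOn (Function.uncurry F') (U ×ˢ univ))
    (hd : ∀ r ∈ U, ∀ θ, HasDerivAt (fun r => F r θ) (F' r θ) r) (a b : ℝ) {r₀ : ℝ}
    (hr : r₀ ∈ U) :
    HasDerivAt (fun r => ∫ θ in a..b, F r θ) (∫ θ in a..b, F' r₀ θ) r₀ := by
  obtain ⟨δ, hδ, hball⟩ := Metric.nhds_basis_closedBall.mem_iff.1 (hU.mem_nhds hr)
  have hsec : ∀ {G : ℝ → ℝ → ℝ}, ContinuousOn (Function.uncurry G) (U ×ˢ univ) →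
      ∀ r ∈ U, Continuous (G r) := fun hG r hrU =>
    hG.comp_continuous (f := fun θ : ℝ => (r, θ)) (by fun_prop) (fun θ => ⟨hrU, mem_univ _⟩)
  have hcpt := (isCompact_closedBall r₀ δ).prod (isCompact_uIcc (a := a) (b := b))
  obtain ⟨C, hC⟩ := hcpt.exists_bound_of_continuousOn
    (hF'.mono (prod_mono hball (subset_univ _)))
  have hUm : ∀ᶠ r in 𝓝 r₀, r ∈ U := hU.mem_nhds hr
  refine (intervalIntegral.hasDerivAt_integral_of_dominated_loc_of_deriv_le (bound := fun _ => C)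
    (Metric.closedBall_mem_nhds r₀ hδ) ?_ ?_ ?_ ?_ ?_ ?_).2
  · filter_upwards [hUm] with r hrU
    exact (hsec hF r hrU).aestronglyMeasurable
  · exact (hsec hF r₀ hr).intervalIntegrable _ _
  · exact (hsec hF' r₀ hr).aestronglyMeasurable
  · refine Eventually.of_forall fun θ hθ r hrb => ?_
    exact hC (r, θ) ⟨hrb, uIoc_subset_uIcc hθ⟩
  · exact intervalIntegrable_const
  · exact Eventually.of_forall fun θ _ r hrb => hd r (hball hrb) θ

/-- Signs of a function near a simple zero. -/
theorem eventually_sign_of_hasDerivAt {φ : ℝ → ℝ} {c r₀ : ℝ} (hφ : HasDerivAt φ c r₀)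
    (h0 : φ r₀ = 0) (hc : c ≠ 0) :
    ∃ κ > 0, ∀ ρ, 0 < ρ → ρ < κ → 0 < c * φ (r₀ + ρ) ∧ c * φ (r₀ - ρ) < 0 := by
  have hcc := mul_self_pos.2 hc
  have hsign : ∀ᶠ r in 𝓝[≠] r₀, 0 < c * slope φ r₀ r :=
    ((hasDerivAt_iff_tendsto_slope.1 hφ).const_mul c).eventually (lt_mem_nhds hcc)
  obtain ⟨κ, hκ, hκs⟩ := Metric.mem_nhdsWithin_iff.1 hsign
  refine ⟨κ, hκ, fun ρ hρ0 hρ => ⟨?_, ?_⟩⟩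
  · have : 0 < c * slope φ r₀ (r₀ + ρ) :=
      hκs ⟨by simpa [abs_of_pos hρ0] using hρ, by simp [hρ0.ne']⟩
    rw [slope_def_field, h0, add_sub_cancel_left, sub_zero, ← mul_div_assoc] at this
    exact (div_pos_iff_of_pos_right hρ0).1 this
  · have : 0 < c * slope φ r₀ (r₀ - ρ) :=
      hκs ⟨by simpa [Real.dist_eq, abs_of_pos hρ0] using hρ, by simp [hρ0.ne']⟩
    rw [slope_def_field, h0, sub_zero, ← mul_div_assoc, show r₀ - ρ - r₀ = -ρ by ring, div_neg,
      neg_pos] at this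
    by_contra h
    exact absurd (div_nonneg (not_lt.1 h) hρ0.le) (not_le.2 this)

/-- A simple zero of `Q 0` persists for `Q lam` with `lam` small. -/
theorem eventually_exists_simple_zero {Q Q' : ℝ → ℝ → ℝ} {N : Set (ℝ × ℝ)} (hN : IsOpen N)
    (hQ : ContinuousOn (Function.uncurry Q) N) (hQ' : ContinuousOn (Function.uncurry Q') N)
    (hd : ∀ p ∈ N, HasDerivAt (Q p.1) (Q' p.1 p.2) p.2) {r₀ : ℝ} (hr : ((0 : ℝ), r₀) ∈ N)
    (h0 : Q 0 r₀ = 0) (h1 : Q' 0 r₀ ≠ 0) {η : ℝ} (hη : 0 < η) :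
    ∀ᶠ lam in 𝓝 (0 : ℝ), ∃ r, |r - r₀| < η ∧ (lam, r) ∈ N ∧ Q lam r = 0 ∧ Q' lam r ≠ 0 := by
  have hQ'n : ∀ᶠ p in 𝓝 ((0 : ℝ), r₀), p ∈ N ∧ Q' p.1 p.2 ≠ 0 :=
    (hN.eventually_mem hr).and ((hQ'.continuousAt (hN.mem_nhds hr)).eventually_ne h1)
  obtain ⟨δ, hδ, hball⟩ := Metric.nhds_basis_ball.mem_iff.1 hQ'n
  have hmem : ∀ lam r, |lam| < δ → |r - r₀| < δ → (lam, r) ∈ N ∧ Q' lam r ≠ 0 := by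
    intro lam r hl hr'
    refine @hball (lam, r) ?_
    rw [Metric.mem_ball, Prod.dist_eq, max_lt_iff, Real.dist_eq, Real.dist_eq]
    simpa using ⟨hl, hr'⟩
  have hder := hd (0, r₀) hr
  obtain ⟨κ, hκ, hκs⟩ := eventually_sign_of_hasDerivAt hder h0 h1
  set ρ := min (min δ κ) η / 2 with hρ
  have hρ0 : 0 < ρ := by positivity
  have hm1 : min (min δ κ) η ≤ δ := (min_le_left _ _).trans (min_le_left _ _)
  have hm2 : min (min δ κ) η ≤ κ := (min_le_left _ _).trans (min_le_right _ _)
  have hm3 : min (min δ κ) η ≤ η := min_le_right _ _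
  obtain ⟨hs1, hs2⟩ : 0 < Q' 0 r₀ * Q 0 (r₀ + ρ) ∧ Q' 0 r₀ * Q 0 (r₀ - ρ) < 0 :=
    hκs ρ hρ0 (by linarith)
  have hc : ∀ r, |r - r₀| < δ → ContinuousAt (fun lam => Q' 0 r₀ * Q lam r) 0 := by
    intro r hr'
    have := (hQ.continuousAt (hN.mem_nhds (hmem 0 r (by simpa using hδ) hr').1))
    exact continuousAt_const.mul (this.comp (f := fun lam : ℝ => (lam, r)) (by fun_prop))
  have e1 := (hc (r₀ + ρ) (by simp [abs_of_pos hρ0]; linarith)).eventually (lt_mem_nhds hs1)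
  have e2 := (hc (r₀ - ρ) (by simp [abs_of_pos hρ0]; linarith)).eventually (gt_mem_nhds hs2)
  have e3 : ∀ᶠ lam in 𝓝 (0 : ℝ), |lam| < δ := by
    filter_upwards [Metric.ball_mem_nhds (0 : ℝ) hδ] with lam h
    simpa using h
  filter_upwards [e1, e2, e3] with lam f1 f2 f3
  have habs : ∀ r ∈ Icc (r₀ - ρ) (r₀ + ρ), |r - r₀| ≤ ρ := fun r hr' =>
    abs_le.2 ⟨by linarith [hr'.1], by linarith [hr'.2]⟩
  have hcont : ContinuousOn (fun r => Q' 0 r₀ * Q lam r) (Icc (r₀ - ρ) (r₀ + ρ)) := by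
    intro r hr'
    have := hd (lam, r) (hmem lam r f3 (by linarith [habs r hr'])).1
    exact (this.continuousAt.const_mul _).continuousWithinAt |>.congr (fun _ _ => rfl) rfl
  obtain ⟨r, hr', hz⟩ := intermediate_value_Icc (by linarith) hcont ⟨f2.le, f1.le⟩
  have h2 := hmem lam r f3 (by linarith [habs r hr'])
  refine ⟨r, by linarith [habs r hr'], h2.1, ?_, h2.2⟩
  exact (mul_eq_zero.1 hz).resolve_left h1

/-- A continuous function on `[0, T]` with equal end values extends to a `T`-periodic one. -/
theorem exists_periodic_extension {T : ℝ} (hT : 0 < T) {q : ℝ → ℝ} (hq : ContinuousOn q (Icc 0 T))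
    (h0 : q 0 = q T) :
    ∃ p : ℝ → ℝ, Continuous p ∧ Function.Periodic p T ∧ ∀ θ ∈ Icc 0 T, p θ = q θ := by
  have : Fact (0 < T) := ⟨hT⟩
  have hper : Function.Periodic (fun θ : ℝ => AddCircle.liftIco T 0 q (θ : AddCircle T)) T :=
    fun θ => by simp
  refine ⟨fun θ => AddCircle.liftIco T 0 q (θ : AddCircle T),
    (AddCircle.liftIco_zero_continuous h0 hq).comp (AddCircle.continuous_mk' T), hper, ?_⟩
  intro θ hθ
  rcases hθ.2.lt_or_eq with h | h
  · exact AddCircle.liftIco_zero_coe_apply ⟨hθ.1, h⟩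
  · subst h
    rw [← h0, ← AddCircle.liftIco_zero_coe_apply (f := q) (p := θ) ⟨le_rfl, hT⟩]
    simpa using hper 0

/-- A solution of a `T`-periodic scalar equation on `[0, T]` with equal end values extends to a
periodic solution. -/
theorem exists_periodic_solution_of_Icc {T : ℝ} (hT : 0 < T) {F : ℝ → ℝ → ℝ} {α : ℝ → ℝ}
    (hα : ∀ θ ∈ Icc 0 T, HasDerivWithinAt α (F θ (α θ)) (Icc 0 T) θ) (h0 : α 0 = α T)
    (hF : ContinuousOn (fun θ => F θ (α θ)) (Icc 0 T)) (hper : ∀ θ r, F (θ + T) r = F θ r) :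
    ∃ u : ℝ → ℝ, Function.Periodic u T ∧ (∀ θ, HasDerivAt u (F θ (u θ)) θ) ∧
      ∀ θ ∈ Icc 0 T, u θ = α θ := by
  have hF0 : F 0 (α 0) = F T (α T) := by
    rw [← h0]; simpa using (hper 0 (α 0)).symm
  obtain ⟨p, hpc, hpp, hpq⟩ := exists_periodic_extension hT hF hF0
  have hαc : ContinuousOn α (Icc 0 T) := fun θ hθ => (hα θ hθ).continuousWithinAt
  have hu : ∀ θ ∈ Icc 0 T, α 0 + ∫ s in (0 : ℝ)..θ, p s = α θ := by
    intro θ hθ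
    have : ∫ s in (0 : ℝ)..θ, p s = α θ - α 0 := by
      refine intervalIntegral.integral_eq_sub_of_hasDerivAt_of_le hθ.1
        (hαc.mono (Icc_subset_Icc_right hθ.2)) (fun s hs => ?_) (hpc.intervalIntegrable _ _)
      have hs' : s ∈ Ioo 0 T := ⟨hs.1, hs.2.trans_le hθ.2⟩
      rw [hpq s (Ioo_subset_Icc_self hs')]
      exact (hα s (Ioo_subset_Icc_self hs')).hasDerivAt (Icc_mem_nhds hs'.1 hs'.2)
    rw [this]; ring
  have hzero : ∫ s in (0 : ℝ)..T, p s = 0 := by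
    have := hu T ⟨hT.le, le_rfl⟩
    rw [h0] at this
    linarith
  have hup : Function.Periodic (fun θ => α 0 + ∫ s in (0 : ℝ)..θ, p s) T := by
    intro θ
    have h1 := intervalIntegral.integral_add_adjacent_intervals
      (hpc.intervalIntegrable (μ := volume) 0 θ) (hpc.intervalIntegrable θ (θ + T))
    have h2 := hpp.intervalIntegral_add_eq θ 0
    rw [zero_add, hzero] at h2
    rw [h2] at h1
    simp only
    rw [← h1]; ring
  have hpF : ∀ θ, p θ = F θ (α 0 + ∫ s in (0 : ℝ)..θ, p s) := by
    have hper' : Function.Periodic (fun θ => F θ (α 0 + ∫ s in (0 : ℝ)..θ, p s)) T := by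
      intro θ
      have := hup θ
      simp only at this ⊢
      rw [this, hper]
    intro θ
    obtain ⟨y, hy, hyθ⟩ := (hpp.sub hper').exists_mem_Ico₀ hT θ
    have hy' : y ∈ Icc 0 T := Ico_subset_Icc_self hy
    have : p y - F y (α 0 + ∫ s in (0 : ℝ)..y, p s) = 0 := by
      rw [hu y hy', hpq y hy', sub_self]
    simp only [Pi.sub_apply] at hyθ
    linarith
  refine ⟨_, hup, fun θ => ?_, hu⟩
  rw [← hpF θ]
  exact (hpc.integral_hasStrictDerivAt 0 θ).hasDerivAt.const_add _

theorem uniform_near_zero {v : ℝ → ℝ → ℝ → ℝ} {l b E T : ℝ} (hE : 0 < E)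
    (hv : ContinuousOn (fun p : ℝ × ℝ × ℝ => v p.1 p.2.1 p.2.2)
      (Icc 0 E ×ˢ univ ×ˢ Icc l b)) {e : ℝ} (he : 0 < e) :
    ∃ δ > 0, ∀ ε ∈ Icc 0 E, ε < δ → ∀ θ ∈ Icc 0 T, ∀ r ∈ Icc l b, ∀ r' ∈ Icc l b,
      |r - r'| < δ → |v ε θ r - v 0 θ r'| < e := by
  have hK : IsCompact (Icc 0 E ×ˢ Icc 0 T ×ˢ Icc l b) :=
    isCompact_Icc.prod (isCompact_Icc.prod isCompact_Icc)
  have huc := hK.uniformContinuousOn_of_continuous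
    (hv.mono (prod_mono le_rfl (prod_mono (subset_univ _) le_rfl)))
  obtain ⟨δ, hδ, h⟩ := Metric.uniformContinuousOn_iff.1 huc e he
  refine ⟨δ, hδ, fun ε hε hεδ θ hθ r hr r' hr' hrr => ?_⟩
  have := h (ε, θ, r) ⟨hε, hθ, hr⟩ (0, θ, r') ⟨⟨le_rfl, hE.le⟩, hθ, hr'⟩ ?_
  · simpa [Real.dist_eq] using this
  · simp only [Prod.dist_eq, dist_self, Real.dist_eq, sub_zero, abs_of_nonneg hε.1]
    exact max_lt hεδ (max_lt hδ hrr)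

theorem abs_intervalIntegral_sub_le {f g : ℝ → ℝ} {T e : ℝ} (hT : 0 ≤ T)
    (hf : ContinuousOn f (Icc 0 T)) (hg : ContinuousOn g (Icc 0 T))
    (h : ∀ θ ∈ Icc 0 T, |f θ - g θ| ≤ e) :
    |(∫ θ in (0 : ℝ)..T, f θ) - ∫ θ in (0 : ℝ)..T, g θ| ≤ e * T := by
  rw [← intervalIntegral.integral_sub (hf.intervalIntegrable_of_Icc hT)
    (hg.intervalIntegrable_of_Icc hT)]
  have := intervalIntegral.norm_integral_le_of_norm_le_const (a := 0) (b := T) (C := e)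
    (f := fun θ => f θ - g θ) (fun θ hθ => by
      rw [uIoc_of_le hT] at hθ
      exact h θ (Ioc_subset_Icc_self hθ))
  simpa [abs_of_nonneg hT] using this

/-- First order averaging: a simple zero of the averaged function yields, for all small `ε > 0`,
a periodic solution with nonzero first variation. -/
theorem exists_periodic_solution {v w : ℝ → ℝ → ℝ → ℝ} {r₀ a E T c : ℝ} (ha : 0 < a) (hE : 0 < E)
    (hT : 0 < T)
    (hv : ContinuousOn (fun p : ℝ × ℝ × ℝ => v p.1 p.2.1 p.2.2)
      (Icc 0 E ×ˢ univ ×ˢ Icc (r₀ - a) (r₀ + a)))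
    (hw : ContinuousOn (fun p : ℝ × ℝ × ℝ => w p.1 p.2.1 p.2.2)
      (Icc 0 E ×ˢ univ ×ˢ Icc (r₀ - a) (r₀ + a)))
    (hd : ∀ ε ∈ Icc 0 E, ∀ θ, ∀ r ∈ Icc (r₀ - a) (r₀ + a), HasDerivAt (v ε θ) (w ε θ r) r)
    (hper : ∀ ε θ r, v ε (θ + T) r = v ε θ r)
    (h0 : ∫ θ in (0 : ℝ)..T, v 0 θ r₀ = 0)
    (h1 : HasDerivAt (fun r => ∫ θ in (0 : ℝ)..T, v 0 θ r) c r₀) (hc : c ≠ 0)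
    {η : ℝ} (hη : 0 < η) :
    ∃ ε₀ > 0, ε₀ ≤ E ∧ ∀ ε, 0 < ε → ε ≤ ε₀ → ∃ u : ℝ → ℝ, Function.Periodic u T ∧
      (∀ θ, HasDerivAt u (ε * v ε θ (u θ)) θ) ∧ (∀ θ, |u θ - r₀| < η) ∧ (∀ θ, |u θ - r₀| < a) ∧
      ∫ θ in (0 : ℝ)..T, w ε θ (u θ) ≠ 0 := by
  set I := Icc (r₀ - a) (r₀ + a) with hI
  have hmemI : ∀ r, |r - r₀| ≤ a → r ∈ I := fun r hr =>
    ⟨by linarith [(abs_le.1 hr).1], by linarith [(abs_le.1 hr).2]⟩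
  have h0E : (0 : ℝ) ∈ Icc 0 E := ⟨le_rfl, hE.le⟩
  have hcomp : ∀ {V : ℝ → ℝ → ℝ → ℝ}, ContinuousOn (fun p : ℝ × ℝ × ℝ => V p.1 p.2.1 p.2.2)
      (Icc 0 E ×ˢ univ ×ˢ I) → ∀ ε ∈ Icc 0 E, ∀ y : ℝ → ℝ, ContinuousOn y (Icc 0 T) →
      (∀ θ ∈ Icc 0 T, y θ ∈ I) → ContinuousOn (fun θ => V ε θ (y θ)) (Icc 0 T) := by
    intro V hV ε hε y hy hyI
    exact hV.comp (f := fun θ => (ε, θ, y θ)) (by fun_prop) (fun θ hθ => ⟨hε, mem_univ _, hyI θ hθ⟩)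
  have hc' : ∫ θ in (0 : ℝ)..T, w 0 θ r₀ = c := by
    refine (hasDerivAt_intervalIntegral_param (U := Ioo (r₀ - a) (r₀ + a)) isOpen_Ioo
      (F := fun r θ => v 0 θ r) (F' := fun r θ => w 0 θ r) ?_ ?_ ?_ 0 T
      ⟨by linarith, by linarith⟩).unique h1
    · exact hv.comp (f := fun p : ℝ × ℝ => ((0 : ℝ), p.2, p.1)) (by fun_prop)
        (fun p hp => ⟨h0E, mem_univ _, Ioo_subset_Icc_self hp.1⟩)
    · exact hw.comp (f := fun p : ℝ × ℝ => ((0 : ℝ), p.2, p.1)) (by fun_prop)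
        (fun p hp => ⟨h0E, mem_univ _, Ioo_subset_Icc_self hp.1⟩)
    · exact fun r hr θ => hd 0 h0E θ r (Ioo_subset_Icc_self hr)
  have hK : IsCompact (Icc 0 E ×ˢ Icc 0 T ×ˢ I) :=
    isCompact_Icc.prod (isCompact_Icc.prod isCompact_Icc)
  have hsub : Icc 0 E ×ˢ Icc 0 T ×ˢ I ⊆ Icc 0 E ×ˢ univ ×ˢ I :=
    prod_mono le_rfl (prod_mono (subset_univ _) le_rfl)
  obtain ⟨C₁, hC₁⟩ := hK.exists_bound_of_continuousOn (hv.mono hsub)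
  obtain ⟨C₂, hC₂⟩ := hK.exists_bound_of_continuousOn (hw.mono hsub)
  set C := |C₁| + 1 with hC
  have hCpos : 0 < C := by positivity
  have hvC : ∀ ε ∈ Icc 0 E, ∀ θ ∈ Icc 0 T, ∀ r ∈ I, |v ε θ r| ≤ C := fun ε hε θ hθ r hr =>
    (hC₁ (ε, θ, r) ⟨hε, hθ, hr⟩).trans (by linarith [le_abs_self C₁])
  have hcpos : 0 < |c| := abs_pos.2 hc
  obtain ⟨δw, hδw, hwδ⟩ := uniform_near_zero (T := T) hE hw (e := |c| / (2 * T)) (by positivity)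
  obtain ⟨κ, hκ, hκs⟩ := eventually_sign_of_hasDerivAt h1 h0 hc
  set η' := min (min η a) (min δw κ) / 3 with hη'
  have hη'0 : 0 < η' := by positivity
  have hη1 : 3 * η' ≤ η := by
    rw [hη']
    linarith [(min_le_left (min η a) (min δw κ)).trans (min_le_left _ _)]
  have hη2 : 3 * η' ≤ a := by
    rw [hη']
    linarith [(min_le_left (min η a) (min δw κ)).trans (min_le_right _ _)]
  have hη3 : 3 * η' ≤ δw := by
    rw [hη']
    linarith [(min_le_right (min η a) (min δw κ)).trans (min_le_left _ _)]
  have hη4 : 3 * η' ≤ κ := by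
    rw [hη']
    linarith [(min_le_right (min η a) (min δw κ)).trans (min_le_right _ _)]
  set m : ℝ → ℝ := fun r => ∫ θ in (0 : ℝ)..T, v 0 θ r with hm
  obtain ⟨hs1, hs2⟩ : 0 < c * m (r₀ + η') ∧ c * m (r₀ - η') < 0 := hκs η' hη'0 (by linarith)
  set μ := min (|m (r₀ + η')|) (|m (r₀ - η')|) with hμ
  have hμ0 : 0 < μ := by
    refine lt_min (abs_pos.2 ?_) (abs_pos.2 ?_)
    · rintro h; rw [h, mul_zero] at hs1; exact lt_irrefl _ hs1
    · rintro h; rw [h, mul_zero] at hs2; exact lt_irrefl _ hs2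
  obtain ⟨δv, hδv, hvδ⟩ := uniform_near_zero (T := T) hE hv (e := μ / (2 * T)) (by positivity)
  set ε₀ := min (min E (min δv δw / 2)) (min η' (δv / 2) / (C * T)) with hε₀
  refine ⟨ε₀, by positivity, (min_le_left _ _).trans (min_le_left _ _), fun ε hε hεε₀ => ?_⟩
  have hεE : ε ∈ Icc 0 E := ⟨hε.le, hεε₀.trans ((min_le_left _ _).trans (min_le_left _ _))⟩
  have hεδ : ε ≤ min δv δw / 2 := hεε₀.trans ((min_le_left _ _).trans (min_le_right _ _))
  have hεδv : ε < δv := by linarith [min_le_left δv δw]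
  have hεδw : ε < δw := by linarith [min_le_right δv δw]
  have hεC : ε * C * T ≤ min η' (δv / 2) := by
    have : ε ≤ min η' (δv / 2) / (C * T) := hεε₀.trans (min_le_right _ _)
    rw [le_div_iff₀ (by positivity)] at this
    linarith
  have hεC1 : ε * C * T ≤ η' := hεC.trans (min_le_left _ _)
  have hεC2 : ε * C * T < δv := by linarith [min_le_right η' (δv / 2)]
  -- the clamped vector field
  set cl : ℝ → ℝ := fun r => max (r₀ - a) (min (r₀ + a) r) with hcl
  have hclI : ∀ r, cl r ∈ I := fun r =>
    ⟨le_max_left _ _, max_le (by linarith) (min_le_left _ _)⟩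
  have hcl_id : ∀ r ∈ I, cl r = r := fun r hr => by
    simp only [hcl]; rw [min_eq_right hr.2, max_eq_right hr.1]
  have hball : Metric.closedBall r₀ (a.toNNReal : ℝ) = I := by
    rw [Real.coe_toNNReal _ ha.le, Real.closedBall_eq_Icc]
  have hPL : IsPicardLindelof (fun θ r => ε * v ε θ (cl r)) (tmin := 0) (tmax := T)
      ⟨0, le_rfl, hT.le⟩ r₀ a.toNNReal η'.toNNReal (ε * C).toNNReal (ε * |C₂|).toNNReal := by
    refine ⟨fun θ hθ => ?_, fun r _ => ?_, fun θ hθ r _ => ?_, ?_⟩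
    · rw [hball]
      refine LipschitzOnWith.of_dist_le_mul fun x hx y hy => ?_
      rw [hcl_id x hx, hcl_id y hy, Real.coe_toNNReal _ (by positivity), Real.dist_eq,
        Real.dist_eq, ← mul_sub, abs_mul, abs_of_pos hε, mul_assoc]
      gcongr
      refine Convex.norm_image_sub_le_of_norm_hasDerivWithin_le (s := I) (f := v ε θ)
        (fun z hz => (hd ε hεE θ z hz).hasDerivWithinAt) (fun z hz => ?_) (convex_Icc _ _) hy hx
      exact (hC₂ (ε, θ, z) ⟨hεE, hθ, hz⟩).trans (le_abs_self _)
    · exact continuousOn_const.mul (hcomp hv ε hεE _ continuousOn_const (fun _ _ => hclI r))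
    · rw [Real.coe_toNNReal _ (by positivity), Real.norm_eq_abs, abs_mul, abs_of_pos hε]
      have := hvC ε hεE θ hθ _ (hclI r)
      gcongr
    · rw [Real.coe_toNNReal _ (by positivity), Real.coe_toNNReal _ ha.le,
        Real.coe_toNNReal _ hη'0.le]
      simp only [sub_zero, sub_self, max_eq_left hT.le]
      linarith
  obtain ⟨α, hα, L', hL'⟩ :=
    hPL.exists_forall_mem_closedBall_eq_hasDerivWithinAt_lipschitzOnWith
  have hball' : Metric.closedBall r₀ (η'.toNNReal : ℝ) = Icc (r₀ - η') (r₀ + η') := by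
    rw [Real.coe_toNNReal _ hη'0.le, Real.closedBall_eq_Icc]
  rw [hball'] at hα hL'
  set J := Icc (r₀ - η') (r₀ + η') with hJ
  have hclose : ∀ x ∈ J, ∀ θ ∈ Icc 0 T, |α x θ - x| ≤ ε * C * T := by
    intro x hx θ hθ
    have := (convex_Icc 0 T).norm_image_sub_le_of_norm_hasDerivWithin_le (f := α x)
      (C := ε * C) (fun s hs => (hα x hx).2 s hs) (fun s hs => by
        rw [Real.norm_eq_abs, abs_mul, abs_of_pos hε]
        have := hvC ε hεE s hs _ (hclI (α x s))
        gcongr) (⟨le_rfl, hT.le⟩ : (0 : ℝ) ∈ Icc 0 T) hθ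
    rw [(hα x hx).1, sub_zero, Real.norm_eq_abs, Real.norm_eq_abs, abs_of_nonneg hθ.1] at this
    refine this.trans ?_
    have := hθ.2
    gcongr
  have hJabs : ∀ x ∈ J, |x - r₀| ≤ η' := fun x hx =>
    abs_le.2 ⟨by linarith [hx.1], by linarith [hx.2]⟩
  have hnear : ∀ x ∈ J, ∀ θ ∈ Icc 0 T, |α x θ - r₀| ≤ 2 * η' := by
    intro x hx θ hθ
    have h2 := abs_sub_le (α x θ) x r₀
    linarith [hclose x hx θ hθ, hJabs x hx]
  have hαI : ∀ x ∈ J, ∀ θ ∈ Icc 0 T, α x θ ∈ I := fun x hx θ hθ =>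
    hmemI _ (by linarith [hnear x hx θ hθ])
  have hJI : ∀ x ∈ J, x ∈ I := fun x hx => hmemI _ (by linarith [hJabs x hx])
  have hαd : ∀ x ∈ J, ∀ θ ∈ Icc 0 T, HasDerivWithinAt (α x) (ε * v ε θ (α x θ)) (Icc 0 T) θ := by
    intro x hx θ hθ
    have := (hα x hx).2 θ hθ
    rwa [hcl_id _ (hαI x hx θ hθ)] at this
  have hαc : ∀ x ∈ J, ContinuousOn (α x) (Icc 0 T) := fun x hx θ hθ =>
    (hαd x hx θ hθ).continuousWithinAt
  have hvα : ∀ x ∈ J, ContinuousOn (fun θ => v ε θ (α x θ)) (Icc 0 T) := fun x hx =>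
    hcomp hv ε hεE _ (hαc x hx) (hαI x hx)
  -- the displacement function
  have hD : ∀ x ∈ J, α x T - x = ε * ∫ θ in (0 : ℝ)..T, v ε θ (α x θ) := by
    intro x hx
    rw [← intervalIntegral.integral_const_mul]
    have := intervalIntegral.integral_eq_sub_of_hasDerivAt_of_le hT.le (hαc x hx)
      (f' := fun θ => ε * v ε θ (α x θ))
      (fun s hs => (hαd x hx s (Ioo_subset_Icc_self hs)).hasDerivAt (Icc_mem_nhds hs.1 hs.2))
      ((continuousOn_const.mul (hvα x hx)).intervalIntegrable_of_Icc hT.le)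
    rw [this, (hα x hx).1]
  have hDm : ∀ x ∈ J, |(∫ θ in (0 : ℝ)..T, v ε θ (α x θ)) - m x| ≤ μ / 2 := by
    intro x hx
    have := abs_intervalIntegral_sub_le hT.le (hvα x hx)
      (hcomp hv 0 h0E (fun _ => x) continuousOn_const (fun _ _ => hJI x hx))
      (e := μ / (2 * T)) (fun θ hθ => (hvδ ε hεE hεδv θ hθ _ (hαI x hx θ hθ) x (hJI x hx)
        ((hclose x hx θ hθ).trans_lt hεC2)).le)
    refine this.trans (le_of_eq ?_)
    field_simp
  have hsign : ∀ x ∈ J, μ ≤ |m x| → 0 < m x * (α x T - x) := by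
    intro x hx hμx
    rw [hD x hx]
    have h := abs_le.1 (hDm x hx)
    have : 0 < m x * ∫ θ in (0 : ℝ)..T, v ε θ (α x θ) := by
      rcases le_or_gt 0 (m x) with hmx | hmx
      · rw [abs_of_nonneg hmx] at hμx
        exact mul_pos (by linarith) (by linarith)
      · rw [abs_of_neg hmx] at hμx
        exact mul_pos_of_neg_of_neg hmx (by linarith)
    nlinarith
  have hj1 : r₀ + η' ∈ J := ⟨by linarith, le_rfl⟩
  have hj2 : r₀ - η' ∈ J := ⟨le_rfl, by linarith⟩
  have hp1 := hsign _ hj1 (min_le_left _ _)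
  have hp2 := hsign _ hj2 (min_le_right _ _)
  have hq1 : 0 < c * (α (r₀ + η') T - (r₀ + η')) := by
    by_contra h
    nlinarith [mul_pos hs1 hp1, mul_self_nonneg (m (r₀ + η'))]
  have hq2 : c * (α (r₀ - η') T - (r₀ - η')) < 0 := by
    by_contra h
    have hs2' : 0 < c * -m (r₀ - η') := by linarith [show c * m (r₀ - η') < 0 from hs2]
    nlinarith [mul_pos hs2' hp2, mul_self_nonneg (m (r₀ - η'))]
  have hDc : ContinuousOn (fun x => c * (α x T - x)) J :=
    continuousOn_const.mul (((hL' T ⟨hT.le, le_rfl⟩).continuousOn).sub continuousOn_id)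
  obtain ⟨x, hx, hxz⟩ := intermediate_value_Icc (by linarith) hDc ⟨hq2.le, hq1.le⟩
  have hxT : α x T = x := by
    have := (mul_eq_zero.1 hxz).resolve_left hc
    linarith
  obtain ⟨u, hup, hud, huα⟩ := exists_periodic_solution_of_Icc hT
    (F := fun θ r => ε * v ε θ r) (hαd x hx)
    (by rw [hxT, (hα x hx).1]) (continuousOn_const.mul (hvα x hx))
    (fun θ r => by rw [hper])
  have hu2 : ∀ θ, |u θ - r₀| ≤ 2 * η' := by
    intro θ
    obtain ⟨y, hy, hyθ⟩ := hup.exists_mem_Ico₀ hT θ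
    rw [hyθ, huα y (Ico_subset_Icc_self hy)]
    exact hnear x hx y (Ico_subset_Icc_self hy)
  refine ⟨u, hup, hud, fun θ => by linarith [hu2 θ], fun θ => by linarith [hu2 θ], ?_⟩
  have huc : Continuous u := continuous_iff_continuousAt.2 fun θ => (hud θ).continuousAt
  have huI : ∀ θ, u θ ∈ I := fun θ => hmemI _ (by linarith [hu2 θ])
  have hr₀I : r₀ ∈ I := hmemI _ (by simpa using ha.le)
  have := abs_intervalIntegral_sub_le hT.le
    (hcomp hw ε hεE u huc.continuousOn (fun θ _ => huI θ))
    (hcomp hw 0 h0E (fun _ => r₀) continuousOn_const (fun _ _ => hr₀I))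
    (e := |c| / (2 * T)) (fun θ hθ => (hwδ ε hεE hεδw θ hθ _ (huI θ) _ hr₀I
        (by linarith [hu2 θ])).le)
  rw [hc'] at this
  intro h
  rw [h, zero_sub, abs_neg, show |c| / (2 * T) * T = |c| / 2 by field_simp] at this
  linarith

/-- A closed curve whose velocity is a positive multiple of `V` is, after reparametrization, a
periodic solution of `V`. -/
theorem exists_reparametrization {V : ℝ × ℝ → ℝ × ℝ} {Z : ℝ → ℝ × ℝ} {ω : ℝ → ℝ} {T : ℝ}
    (hT : 0 < T) (hωc : Continuous ω) (hω : ∀ θ, 0 < ω θ) (hωp : Function.Periodic ω T)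
    (hZ : ∀ θ, HasDerivAt Z (ω θ • V (Z θ)) θ) (hZp : Function.Periodic Z T) :
    ∃ γ : ℝ → ℝ × ℝ, (∀ t, HasDerivAt γ (V (γ t)) t) ∧ (∃ P, 0 < P ∧ Function.Periodic γ P) ∧
      range γ = range Z := by
  set τ : ℝ → ℝ := fun θ => ∫ s in (0 : ℝ)..θ, ω s with hτ
  have hτd : ∀ θ, HasDerivAt τ (ω θ) θ := fun θ => (hωc.integral_hasStrictDerivAt 0 θ).hasDerivAt
  have hmono : StrictMono τ := strictMono_of_hasDerivAt_pos hτd hω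
  have hcont : Continuous τ := continuous_iff_continuousAt.2 fun θ => (hτd θ).continuousAt
  have hP : 0 < τ T := by
    have := hmono hT
    simpa [hτ] using this
  have hadd : ∀ θ, τ (θ + T) = τ θ + τ T := fun θ => by
    have h1 := intervalIntegral.integral_add_adjacent_intervals
      (hωc.intervalIntegrable (μ := volume) 0 θ) (hωc.intervalIntegrable θ (θ + T))
    have h2 := hωp.intervalIntegral_add_eq θ 0
    rw [zero_add] at h2
    rw [h2] at h1
    exact h1.symm
  have htop : Tendsto τ atTop atTop := hωp.tendsto_atTop_intervalIntegral_of_pos hP hT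
  have hbot : Tendsto τ atBot atBot := hωp.tendsto_atBot_intervalIntegral_of_pos hP hT
  have hsurj : Function.Surjective τ := hcont.surjective htop hbot
  set e := hmono.orderIsoOfSurjective τ hsurj with he
  have hee : ∀ t, τ (e.symm t) = t := fun t => e.apply_symm_apply t
  have hes : ∀ θ, e.symm (τ θ) = θ := fun t => e.symm_apply_apply t
  refine ⟨fun t => Z (e.symm t), fun t => ?_, ⟨τ T, hP, fun t => ?_⟩, ?_⟩
  · have h1 : HasDerivAt (fun t => e.symm t) (ω (e.symm t))⁻¹ t :=
      HasDerivAt.of_local_left_inverse (e.symm.continuous.continuousAt) (hτd _) (hω _).ne'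
        (Eventually.of_forall hee)
    have := (hZ (e.symm t)).scomp t h1
    rwa [smul_smul, inv_mul_cancel₀ (hω _).ne', one_smul] at this
  · have : e.symm (t + τ T) = e.symm t + T := by
      apply hmono.injective
      rw [hee, hadd, hee]
    simp only [this, hZp _]
  · exact e.symm.surjective.range_comp Z

theorem eq_of_solutions_mem_compact {V : ℝ × ℝ → ℝ × ℝ} (hV : ContDiff ℝ 1 V) {K : Set (ℝ × ℝ)}
    (hK : IsCompact K) {α β : ℝ → ℝ × ℝ} (hα : ∀ t, HasDerivAt α (V (α t)) t)
    (hβ : ∀ t, HasDerivAt β (V (β t)) t) (hαK : ∀ t, α t ∈ K) (hβK : ∀ t, β t ∈ K) {t₀ : ℝ}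
    (h : α t₀ = β t₀) : α = β := by
  obtain ⟨R, hR⟩ := hK.isBounded.subset_closedBall 0
  obtain ⟨L, hL⟩ := (hV.contDiffOn (s := Metric.closedBall 0 R)).exists_lipschitzOnWith
    one_ne_zero (convex_closedBall _ _) (isCompact_closedBall _ _)
  exact ODE_solution_unique_univ (v := fun _ => V) (s := fun _ => Metric.closedBall 0 R) (K := L)
    (fun _ => hL) (fun t => ⟨hα t, hR (hαK t)⟩) (fun t => ⟨hβ t, hR (hβK t)⟩) h

theorem Function.Periodic.eq_of_monotone {f : ℝ → ℝ} {T : ℝ} (hf : Function.Periodic f T)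
    (hT : 0 < T) (hm : Monotone f) (x y : ℝ) : f x = f y := by
  have key : ∀ x y, f x ≤ f y := by
    intro x y
    obtain ⟨n, hn⟩ := exists_nat_gt ((x - y) / T)
    rw [div_lt_iff₀ hT] at hn
    calc f x ≤ f (y + n * T) := hm (by linarith)
      _ = f y := hf.nat_mul n y
  exact le_antisymm (key x y) (key y x)

/-- Coordinates `(θ, r)` near a periodic orbit: uniform remainder estimate for the first
variation. -/
theorem exists_uniform_linearization {h w : ℝ → ℝ → ℝ} {u : ℝ → ℝ} {r₀ a T e : ℝ} (ha : 0 < a)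
    (hT : 0 < T) (hw : ContinuousOn (Function.uncurry w) (univ ×ˢ Icc (r₀ - a) (r₀ + a)))
    (hd : ∀ θ, ∀ r ∈ Icc (r₀ - a) (r₀ + a), HasDerivAt (h θ) (w θ r) r)
    (hhp : ∀ θ r, h (θ + T) r = h θ r) (hwp : ∀ θ r, w (θ + T) r = w θ r)
    (hup : Function.Periodic u T) (hu : ∀ θ, |u θ - r₀| < a / 2) (he : 0 < e) :
    ∃ κ > 0, κ ≤ a / 2 ∧ ∀ θ r, |r - u θ| < κ →
      |h θ r - h θ (u θ) - w θ (u θ) * (r - u θ)| ≤ e * |r - u θ| := by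
  have huc := (isCompact_Icc.prod isCompact_Icc :
    IsCompact (Icc 0 T ×ˢ Icc (r₀ - a) (r₀ + a))).uniformContinuousOn_of_continuous
      (hw.mono (prod_mono (subset_univ _) le_rfl))
  obtain ⟨δ, hδ, hδw⟩ := Metric.uniformContinuousOn_iff.1 huc e he
  refine ⟨min δ (a / 2), by positivity, min_le_right _ _, ?_⟩
  intro θ
  have hper : Function.Periodic (fun θ => ∀ r, |r - u θ| < min δ (a / 2) →
      |h θ r - h θ (u θ) - w θ (u θ) * (r - u θ)| ≤ e * |r - u θ|) T := fun θ => by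
    simp only [hup θ, hhp, hwp]
  obtain ⟨y, hy, hyθ⟩ := hper.exists_mem_Ico₀ hT θ
  refine hyθ.mpr fun r hr => ?_
  have hseg : ∀ z ∈ uIcc (u y) r, |z - u y| < min δ (a / 2) := fun z hz =>
    (abs_sub_left_of_mem_uIcc hz).trans_lt hr
  have hI : ∀ z ∈ uIcc (u y) r, z ∈ Icc (r₀ - a) (r₀ + a) := fun z hz => by
    have h1 := abs_lt.1 (hseg z hz)
    have h2 := abs_lt.1 (hu y)
    have h3 := min_le_right δ (a / 2)
    exact ⟨by linarith, by linarith⟩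
  have := (convex_uIcc (u y) r).norm_image_sub_le_of_norm_hasDerivWithin_le
    (f := fun z => h y z - w y (u y) * z) (f' := fun z => w y z - w y (u y)) (C := e)
    (fun z hz => (((hd y z (hI z hz)).sub
      ((hasDerivAt_id z).const_mul (w y (u y)))).congr_deriv (by simp)).hasDerivWithinAt)
    (fun z hz => by
      have := hδw (y, z) ⟨Ico_subset_Icc_self hy, hI z hz⟩ (y, u y)
        ⟨Ico_subset_Icc_self hy, hI _ left_mem_uIcc⟩ (by
          simp only [Prod.dist_eq, dist_self, Real.dist_eq]
          exact max_lt hδ ((hseg z hz).trans_le (min_le_left _ _)))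
      exact this.le) left_mem_uIcc right_mem_uIcc
  simp only [Real.norm_eq_abs] at this
  convert this using 2
  ring

theorem exists_periodic_weight {A : ℝ → ℝ} {T : ℝ} (hT : 0 < T) (hA : Continuous A)
    (hAp : Function.Periodic A T) :
    ∃ σ : ℝ → ℝ, Function.Periodic σ T ∧ (∀ θ, 0 < σ θ) ∧
      ∀ θ, HasDerivAt σ (((∫ s in (0 : ℝ)..T, A s) / T - A θ) * σ θ) θ := by
  set M := (∫ s in (0 : ℝ)..T, A s) / T with hM
  have hc : Continuous fun s => M - A s := by fun_prop
  have hp : Function.Periodic (fun s => M - A s) T := fun s => by simp [hAp s]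
  refine ⟨fun θ => Real.exp (∫ s in (0 : ℝ)..θ, (M - A s)), fun θ => ?_, fun θ => Real.exp_pos _,
    fun θ => ?_⟩
  · have h1 := intervalIntegral.integral_add_adjacent_intervals
      (hc.intervalIntegrable (μ := volume) 0 θ) (hc.intervalIntegrable θ (θ + T))
    have h2 := hp.intervalIntegral_add_eq θ 0
    have h3 : ∫ s in (0 : ℝ)..T, (M - A s) = 0 := by
      rw [intervalIntegral.integral_sub (by simp) (hA.intervalIntegrable _ _),
        intervalIntegral.integral_const, hM, sub_zero, smul_eq_mul, mul_div_cancel₀ _ hT.ne',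
        sub_self]
    rw [zero_add, h3] at h2
    rw [h2, add_zero] at h1
    simp only [h1]
  · have := (hc.integral_hasStrictDerivAt 0 θ).hasDerivAt.exp
    rwa [mul_comm] at this

/-- A periodic solution with nonzero first variation, written in coordinates `Φ(θ, r)`, is a limit
cycle. -/
theorem isLimitCycle_of_coordinates {V : ℝ × ℝ → ℝ × ℝ} (hV : ContDiff ℝ 1 V)
    {Φ : ℝ × ℝ → ℝ × ℝ} {Φ' : ℝ × ℝ → ((ℝ × ℝ) ≃L[ℝ] (ℝ × ℝ))} {h w : ℝ → ℝ → ℝ}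
    {ω : ℝ × ℝ → ℝ} {u : ℝ → ℝ} {r₀ a T : ℝ} (ha : 0 < a) (hT : 0 < T)
    (hΦ : ∀ p, p.2 ∈ Ioo (r₀ - a) (r₀ + a) →
      HasStrictFDerivAt Φ (Φ' p : (ℝ × ℝ) →L[ℝ] (ℝ × ℝ)) p)
    (hΦp : ∀ θ r, Φ (θ + T, r) = Φ (θ, r))
    (hinj : ∀ p q, p.2 ∈ Ioo (r₀ - a) (r₀ + a) → q.2 ∈ Ioo (r₀ - a) (r₀ + a) → Φ p = Φ q →
      p.2 = q.2 ∧ ∃ k : ℤ, p.1 = q.1 + k * T)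
    (hωc : ContinuousOn ω (univ ×ˢ Icc (r₀ - a) (r₀ + a)))
    (hω : ∀ p, p.2 ∈ Ioo (r₀ - a) (r₀ + a) → 0 < ω p)
    (hωp : ∀ θ r, ω (θ + T, r) = ω (θ, r))
    (hVΦ : ∀ p, p.2 ∈ Ioo (r₀ - a) (r₀ + a) → Φ' p (1, h p.1 p.2) = ω p • V (Φ p))
    (hw : ContinuousOn (Function.uncurry w) (univ ×ˢ Icc (r₀ - a) (r₀ + a)))
    (hd : ∀ θ, ∀ r ∈ Icc (r₀ - a) (r₀ + a), HasDerivAt (h θ) (w θ r) r)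
    (hhp : ∀ θ r, h (θ + T) r = h θ r) (hwp : ∀ θ r, w (θ + T) r = w θ r)
    (hup : Function.Periodic u T) (hu : ∀ θ, |u θ - r₀| < a / 2)
    (hud : ∀ θ, HasDerivAt u (h θ (u θ)) θ) (hne : ∫ θ in (0 : ℝ)..T, w θ (u θ) ≠ 0) :
    IsLimitCycle V (range fun θ => Φ (θ, u θ)) := by
  have huI : ∀ θ, u θ ∈ Ioo (r₀ - a) (r₀ + a) := fun θ => by
    have := abs_lt.1 (hu θ); exact ⟨by linarith, by linarith⟩
  have huc : Continuous u := continuous_iff_continuousAt.2 fun θ => (hud θ).continuousAt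
  set Z : ℝ → ℝ × ℝ := fun θ => Φ (θ, u θ) with hZ
  have hZp : Function.Periodic Z T := fun θ => by simp only [hZ, hup θ, hΦp]
  have hZd : ∀ θ, HasDerivAt Z (ω (θ, u θ) • V (Z θ)) θ := by
    intro θ
    have h1 : HasDerivAt (fun θ => (θ, u θ)) ((1 : ℝ), h θ (u θ)) θ :=
      (hasDerivAt_id θ).prodMk (hud θ)
    have h2 := (hΦ (θ, u θ) (huI θ)).hasFDerivAt.comp_hasDerivAt θ h1
    have h3 := hVΦ (θ, u θ) (huI θ)
    simp only at h3
    rw [← h3]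
    exact h2
  have hZc : Continuous Z := continuous_iff_continuousAt.2 fun θ => (hZd θ).continuousAt
  have hcompu : ∀ {q : ℝ × ℝ → ℝ}, ContinuousOn q (univ ×ˢ Icc (r₀ - a) (r₀ + a)) →
      Continuous fun θ => q (θ, u θ) := fun {q} hq => by
    rw [← continuousOn_univ]
    exact hq.comp (f := fun θ => (θ, u θ)) (by fun_prop)
      (fun θ _ => ⟨mem_univ _, Ioo_subset_Icc_self (huI θ)⟩)
  have hωuc : Continuous fun θ => ω (θ, u θ) := hcompu hωc
  obtain ⟨γ, hγd, ⟨P, hP, hγP⟩, hγr⟩ := exists_reparametrization hT hωuc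
    (fun θ => hω _ (huI θ)) (fun θ => by simp only [hup θ, hωp]) hZd hZp
  have hrc : IsCompact (range Z) := by
    have : range Z = Z '' Icc 0 T := by
      refine Subset.antisymm ?_ (image_subset_range _ _)
      rintro _ ⟨θ, rfl⟩
      obtain ⟨y, hy, hyθ⟩ := hZp.exists_mem_Ico₀ hT θ
      exact ⟨y, Ico_subset_Icc_self hy, hyθ.symm⟩
    rw [this]
    exact isCompact_Icc.image hZc
  have hnc : Z 0 ≠ Z (T / 2) := by
    intro hZ0
    obtain ⟨-, k, hk⟩ := hinj _ _ (huI 0) (huI (T / 2)) hZ0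
    simp only at hk
    have h1 : (2 * k + 1 : ℝ) * T = 0 := by linarith
    rcases mul_eq_zero.1 h1 with h2 | h2
    · have : 2 * k + 1 = 0 := by exact_mod_cast h2
      omega
    · exact hT.ne' h2
  refine ⟨⟨γ, hγd, ⟨P, hP, hγP⟩, ?_, hγr.symm⟩, ?_⟩
  · obtain ⟨t₁, ht₁⟩ : Z 0 ∈ range γ := hγr ▸ mem_range_self _
    obtain ⟨t₂, ht₂⟩ : Z (T / 2) ∈ range γ := hγr ▸ mem_range_self _
    exact ⟨t₁, t₂, by rwa [ht₁, ht₂]⟩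
  obtain ⟨σ, hσp, hσ0, hσd⟩ := exists_periodic_weight hT (A := fun θ => w θ (u θ)) (hcompu hw)
    (fun θ => by simp only [hup θ, hwp])
  set M := (∫ s in (0 : ℝ)..T, w s (u s)) / T with hM
  have hM0 : M ≠ 0 := div_ne_zero hne hT.ne'
  obtain ⟨κ, hκ, hκa, hκr⟩ := exists_uniform_linearization ha hT hw hd hhp hwp hup hu
    (e := |M| / 2) (by positivity)
  set W : Set (ℝ × ℝ) := {p | |p.2 - u p.1| < κ} with hW
  have hWo : IsOpen W := isOpen_lt (by fun_prop) continuous_const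
  have hWI : ∀ p ∈ W, p.2 ∈ Ioo (r₀ - a) (r₀ + a) := fun p hp => by
    have h1 := abs_lt.1 (hu p.1)
    have h2 := abs_lt.1 (show |p.2 - u p.1| < κ from hp)
    exact ⟨by linarith, by linarith⟩
  refine ⟨Φ '' W, ?_, ?_, ?_⟩
  · rw [isOpen_iff_mem_nhds]
    rintro _ ⟨p, hp, rfl⟩
    rw [← (hΦ p (hWI p hp)).map_nhds_eq_of_equiv]
    exact image_mem_map (hWo.mem_nhds hp)
  · rintro _ ⟨θ, rfl⟩
    exact ⟨(θ, u θ), by simpa [hW] using hκ, rfl⟩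
  rintro Γ' ⟨ζ, hζd, ⟨P', hP', hζP⟩, -, rfl⟩ hΓ
  set E : ℝ × ℝ → ℝ := fun p => M * (σ p.1 * (p.2 - u p.1)) ^ 2 with hE
  have hEp : ∀ p q, p.2 = q.2 → (∃ k : ℤ, p.1 = q.1 + k * T) → E p = E q := by
    rintro ⟨θ, r⟩ ⟨θ', r'⟩ h1 ⟨k, h2⟩
    simp only at h1 h2
    subst h1 h2
    have e1 : σ (θ' + k * T) = σ θ' := hσp.int_mul k θ'
    have e2 : u (θ' + k * T) = u θ' := hup.int_mul k θ'
    simp only [hE, e1, e2]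
  choose! pt hptW hptζ using fun t => hΓ (mem_range_self t)
  have key : ∀ t, ∃ d, HasDerivAt (fun t => E (pt t)) d t ∧ 0 ≤ d ∧
      (d = 0 → (pt t).2 = u (pt t).1) := by
    intro t
    set p := pt t with hp
    have hpI := hWI p (hptW t)
    have hs := hΦ p hpI
    set Ψ := hs.localInverse Φ (Φ' p) p with hΨ
    have hΨd : HasStrictFDerivAt Ψ ((Φ' p).symm : (ℝ × ℝ) →L[ℝ] (ℝ × ℝ)) (ζ t) := by
      have := hs.to_localInverse
      rwa [hptζ t] at this
    have hΨp : Ψ (ζ t) = p := by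
      have := hs.localInverse_apply_image
      rwa [hptζ t] at this
    have hΨr : ∀ᶠ s in 𝓝 t, Φ (Ψ (ζ s)) = ζ s := by
      have := hs.eventually_right_inverse
      rw [hptζ t] at this
      exact (hζd t).continuousAt.eventually this
    have hcd : HasDerivAt (fun s => Ψ (ζ s)) ((Φ' p).symm (V (ζ t))) t :=
      hΨd.hasFDerivAt.comp_hasDerivAt t (hζd t)
    have hΨW : ∀ᶠ s in 𝓝 t, Ψ (ζ s) ∈ W :=
      hcd.continuousAt.eventually (hWo.mem_nhds (by
        change Ψ (ζ t) ∈ W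
        rw [hΨp]
        exact hptW t))
    have hEE : (fun s => E (pt s)) =ᶠ[𝓝 t] fun s => E (Ψ (ζ s)) := by
      filter_upwards [hΨr, hΨW] with s h1 h2
      have := hinj (pt s) (Ψ (ζ s)) (hWI _ (hptW s)) (hWI _ h2) (by rw [hptζ s, h1])
      exact hEp _ _ this.1 this.2
    have hωp0 := hω p hpI
    have hval : (Φ' p).symm (V (ζ t)) = (ω p)⁻¹ • ((1 : ℝ), h p.1 p.2) := by
      rw [ContinuousLinearEquiv.symm_apply_eq, map_smul, hVΦ p hpI, smul_smul,
        inv_mul_cancel₀ hωp0.ne', one_smul, hptζ t]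
    rw [hval] at hcd
    have hc1 : HasDerivAt (fun s => (Ψ (ζ s)).1) (ω p)⁻¹ t := by
      exact ((ContinuousLinearMap.fst ℝ ℝ ℝ).hasFDerivAt.comp_hasDerivAt t hcd).congr_deriv
          (by simp)
    have hc2 : HasDerivAt (fun s => (Ψ (ζ s)).2) ((ω p)⁻¹ * h p.1 p.2) t := by
      exact ((ContinuousLinearMap.snd ℝ ℝ ℝ).hasFDerivAt.comp_hasDerivAt t hcd).congr_deriv
          (by simp)
    have hu1 : HasDerivAt (fun s => u (Ψ (ζ s)).1) (h p.1 (u p.1) * (ω p)⁻¹) t := by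
      have : HasDerivAt u (h p.1 (u p.1)) (Ψ (ζ t)).1 := by rw [hΨp]; exact hud p.1
      exact this.comp t hc1
    have hσ1 : HasDerivAt (fun s => σ (Ψ (ζ s)).1)
        ((M - w p.1 (u p.1)) * σ p.1 * (ω p)⁻¹) t := by
      have : HasDerivAt σ ((M - w p.1 (u p.1)) * σ p.1) (Ψ (ζ t)).1 := by
        rw [hΨp]; exact hσd p.1
      exact this.comp t hc1
    have hEd := ((hσ1.mul (hc2.sub hu1)).pow 2).const_mul M
    have hκ' := hκr p.1 p.2 (hptW t)
    set x := p.2 - u p.1 with hx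
    set rem := h p.1 p.2 - h p.1 (u p.1) - w p.1 (u p.1) * x with hrem
    refine ⟨(ω p)⁻¹ * (2 * (σ p.1) ^ 2 * (M ^ 2 * x ^ 2 + M * x * rem)), ?_, ?_, ?_⟩
    · refine (hEd.congr_of_eventuallyEq hEE).congr_deriv ?_
      simp only [hΨp, Pi.mul_apply, Pi.sub_apply, hrem, hx]
      push_cast
      ring
    all_goals
      have hb : M ^ 2 * x ^ 2 / 2 ≤ M ^ 2 * x ^ 2 + M * x * rem := by
        have h1 : |M * x * rem| ≤ |M| * |x| * (|M| / 2 * |x|) := by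
          rw [abs_mul, abs_mul]; gcongr
        have h2 : |M| * |x| * (|M| / 2 * |x|) = M ^ 2 * x ^ 2 / 2 := by
          rw [← sq_abs M, ← sq_abs x]; ring
        rw [h2] at h1
        linarith [(abs_le.1 h1).1]
    · have : 0 ≤ M ^ 2 * x ^ 2 + M * x * rem := le_trans (by positivity) hb
      positivity
    · intro h0
      have hσp := hσ0 p.1
      have h1 : M ^ 2 * x ^ 2 + M * x * rem = 0 := by
        by_contra h
        exact (mul_ne_zero (inv_ne_zero hωp0.ne') (mul_ne_zero (by positivity) h)) h0
      rw [h1] at hb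
      have : M ^ 2 * x ^ 2 = 0 := le_antisymm (by linarith) (by positivity)
      have hx0 : x = 0 := by simpa [hM0] using this
      linarith
  choose d hd1 hd2 hd3 using key
  have hmono : Monotone fun t => E (pt t) := monotone_of_hasDerivAt_nonneg hd1 hd2
  have hper : Function.Periodic (fun t => E (pt t)) P' := fun t => by
    have := hinj (pt (t + P')) (pt t) (hWI _ (hptW _)) (hWI _ (hptW _))
      (by rw [hptζ, hptζ, hζP])
    exact hEp _ _ this.1 this.2
  have hd0 : ∀ t, d t = 0 := fun t => by
    have hconst : (fun t => E (pt t)) = fun _ => E (pt 0) :=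
      funext fun s => hper.eq_of_monotone hP' hmono s 0
    have := hd1 t
    rw [hconst] at this
    exact this.unique (hasDerivAt_const t _)
  have hζZ : ∀ t, ζ t ∈ range Z := fun t => by
    refine ⟨(pt t).1, ?_⟩
    simp only [hZ]
    rw [← hd3 t (hd0 t), ← hptζ t]
  have hγZ : ∀ t, γ t ∈ range Z := fun t => hγr ▸ mem_range_self t
  obtain ⟨s, hs⟩ : ζ 0 ∈ range γ := hγr ▸ hζZ 0
  have heq : ζ = fun t => γ (t + s) := by
    refine eq_of_solutions_mem_compact hV hrc hζd (fun t => ?_) hζZ (fun t => hγZ _)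
      (t₀ := 0) (by simp [hs])
    exact (hγd (t + s)).comp_add_const t s
  rw [heq, ← hγr]
  exact (Equiv.addRight s).surjective.range_comp γ

/-- The scalar equation `dr/dθ = ε v` of a perturbed linear center in polar coordinates. -/
noncomputable def polarField (F : ℝ → ℝ) (ε θ r : ℝ) : ℝ :=
  -(F (r * Real.cos θ) * r * Real.sin θ ^ 2) /
    (1 - ε * F (r * Real.cos θ) * (Real.sin θ * Real.cos θ))

/-- The radial derivative of `polarField`; `F₁` is the derivative of `F`. -/
noncomputable def polarFieldDeriv (F F₁ : ℝ → ℝ) (ε θ r : ℝ) : ℝ :=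
  (-((F₁ (r * Real.cos θ) * Real.cos θ * r + F (r * Real.cos θ)) * Real.sin θ ^ 2) *
      (1 - ε * F (r * Real.cos θ) * (Real.sin θ * Real.cos θ)) -
    -(F (r * Real.cos θ) * r * Real.sin θ ^ 2) *
      (-(ε * (F₁ (r * Real.cos θ) * Real.cos θ) * (Real.sin θ * Real.cos θ)))) /
    (1 - ε * F (r * Real.cos θ) * (Real.sin θ * Real.cos θ)) ^ 2

theorem hasDerivAt_polarField {F F₁ : ℝ → ℝ} {ε θ r : ℝ}
    (hF : HasDerivAt F (F₁ (r * Real.cos θ)) (r * Real.cos θ))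
    (hden : 1 - ε * F (r * Real.cos θ) * (Real.sin θ * Real.cos θ) ≠ 0) :
    HasDerivAt (polarField F ε θ) (polarFieldDeriv F F₁ ε θ r) r := by
  have h1 : HasDerivAt (fun r => F (r * Real.cos θ)) (F₁ (r * Real.cos θ) * Real.cos θ) r :=
    hF.comp r (by simpa using (hasDerivAt_id r).mul_const (Real.cos θ))
  have h2 := ((h1.mul (hasDerivAt_id r)).mul_const (Real.sin θ ^ 2)).neg
  have h3 := ((h1.const_mul ε).mul_const (Real.sin θ * Real.cos θ)).const_sub 1
  refine (h2.div h3 hden).congr_deriv ?_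
  simp [polarFieldDeriv]

theorem abs_mul_cos_le {r b : ℝ} (hr : |r| ≤ b) (θ : ℝ) : |r * Real.cos θ| ≤ b := by
  rw [abs_mul]
  calc |r| * |Real.cos θ| ≤ |r| * 1 := by gcongr; exact Real.abs_cos_le_one θ
    _ ≤ b := by rwa [mul_one]

theorem mul_cos_mem_Ioo {r R : ℝ} (hr : |r| < R) (θ : ℝ) : r * Real.cos θ ∈ Ioo (-R) R :=
  abs_lt.1 ((abs_mul_cos_le le_rfl θ).trans_lt hr)

/-- Averaging for perturbed linear centers in polar coordinates. -/
theorem exists_polar_periodic_solution {F F₁ : ℝ → ℝ} {R r₀ c : ℝ} (hr₀ : 0 < r₀) (hR : r₀ < R)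
    (hF : ∀ s ∈ Ioo (-R) R, HasDerivAt F (F₁ s) s) (hF₁ : ContinuousOn F₁ (Ioo (-R) R))
    (h0 : ∫ θ in (0 : ℝ)..2 * Real.pi, F (r₀ * Real.cos θ) * Real.sin θ ^ 2 = 0)
    (h1 : HasDerivAt (fun r => ∫ θ in (0 : ℝ)..2 * Real.pi,
      F (r * Real.cos θ) * Real.sin θ ^ 2) c r₀) (hc : c ≠ 0) {η : ℝ} (hη : 0 < η) :
    ∃ a > 0, 0 < r₀ - a ∧ r₀ + a < R ∧ ∃ ε₀ > 0, ∀ ε, 0 < ε → ε ≤ ε₀ →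
      (∀ θ, ∀ r ∈ Icc (r₀ - a) (r₀ + a),
        0 < 1 - ε * F (r * Real.cos θ) * (Real.sin θ * Real.cos θ)) ∧
      ContinuousOn (Function.uncurry (polarFieldDeriv F F₁ ε)) (univ ×ˢ Icc (r₀ - a) (r₀ + a)) ∧
      ∃ u : ℝ → ℝ, Function.Periodic u (2 * Real.pi) ∧
        (∀ θ, HasDerivAt u (ε * polarField F ε θ (u θ)) θ) ∧ (∀ θ, |u θ - r₀| < η) ∧
        (∀ θ, |u θ - r₀| < a / 2) ∧
        ∫ θ in (0 : ℝ)..2 * Real.pi, polarFieldDeriv F F₁ ε θ (u θ) ≠ 0 := by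
  set a := min r₀ (R - r₀) / 2 with ha
  have ha0 : 0 < a := by have : 0 < R - r₀ := by linarith
                         positivity
  have ha1 : 2 * a ≤ r₀ := by linarith [min_le_left r₀ (R - r₀)]
  have ha2 : 2 * a ≤ R - r₀ := by linarith [min_le_right r₀ (R - r₀)]
  have hFc : ContinuousOn F (Ioo (-R) R) := fun s hs => (hF s hs).continuousAt.continuousWithinAt
  obtain ⟨C, hC⟩ := (isCompact_Icc (a := -(r₀ + a)) (b := r₀ + a)).exists_bound_of_continuousOn
    (hFc.mono (Icc_subset_Ioo (by linarith) (by linarith)))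
  have habs : ∀ r ∈ Icc (r₀ - a) (r₀ + a), |r| ≤ r₀ + a := fun r hr =>
    abs_le.2 ⟨by linarith [hr.1], hr.2⟩
  set E := 1 / (2 * (|C| + 1)) with hE
  have hE0 : 0 < E := by positivity
  have hden : ∀ ε ∈ Icc 0 E, ∀ θ, ∀ r ∈ Icc (r₀ - a) (r₀ + a),
      0 < 1 - ε * F (r * Real.cos θ) * (Real.sin θ * Real.cos θ) := by
    intro ε hε θ r hr
    have h2 := hC _ (abs_le.1 (abs_mul_cos_le (habs r hr) θ))
    have h3 : |ε * F (r * Real.cos θ) * (Real.sin θ * Real.cos θ)| ≤ E * |C| * (1 * 1) := by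
      rw [abs_mul, abs_mul, abs_mul, abs_of_nonneg hε.1]
      have := hε.2
      have := h2.trans (le_abs_self C)
      rw [Real.norm_eq_abs] at this
      gcongr
      · exact Real.abs_sin_le_one θ
      · exact Real.abs_cos_le_one θ
    have h4 : E * |C| < 1 := by
      rw [hE, div_mul_eq_mul_div, one_mul, div_lt_one (by positivity)]
      linarith [abs_nonneg C]
    linarith [(abs_le.1 h3).2]
  have hmap : MapsTo (fun p : ℝ × ℝ × ℝ => p.2.2 * Real.cos p.2.1)
      (Icc 0 E ×ˢ univ ×ˢ Icc (r₀ - a) (r₀ + a)) (Ioo (-R) R) := fun p hp =>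
    mul_cos_mem_Ioo ((habs _ hp.2.2).trans_lt (by linarith)) _
  have hcF : ContinuousOn (fun p : ℝ × ℝ × ℝ => F (p.2.2 * Real.cos p.2.1))
      (Icc 0 E ×ˢ univ ×ˢ Icc (r₀ - a) (r₀ + a)) := hFc.comp (by fun_prop) hmap
  have hcF₁ : ContinuousOn (fun p : ℝ × ℝ × ℝ => F₁ (p.2.2 * Real.cos p.2.1))
      (Icc 0 E ×ˢ univ ×ˢ Icc (r₀ - a) (r₀ + a)) := hF₁.comp (by fun_prop) hmap
  have hv : ContinuousOn (fun p : ℝ × ℝ × ℝ => polarField F p.1 p.2.1 p.2.2)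
      (Icc 0 E ×ˢ univ ×ˢ Icc (r₀ - a) (r₀ + a)) := by
    unfold polarField
    refine ContinuousOn.div (by fun_prop) (by fun_prop) fun p hp => ?_
    exact (hden p.1 hp.1 _ _ hp.2.2).ne'
  have hw : ContinuousOn (fun p : ℝ × ℝ × ℝ => polarFieldDeriv F F₁ p.1 p.2.1 p.2.2)
      (Icc 0 E ×ˢ univ ×ˢ Icc (r₀ - a) (r₀ + a)) := by
    unfold polarFieldDeriv
    refine ContinuousOn.div (by fun_prop) (by fun_prop) fun p hp => ?_
    exact (pow_pos (hden p.1 hp.1 _ _ hp.2.2) 2).ne'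
  have hmean : ∀ r, ∫ θ in (0 : ℝ)..2 * Real.pi, polarField F 0 θ r =
      -r * ∫ θ in (0 : ℝ)..2 * Real.pi, F (r * Real.cos θ) * Real.sin θ ^ 2 := fun r => by
    rw [← intervalIntegral.integral_const_mul]
    congr 1
    ext θ
    simp only [polarField]
    ring
  obtain ⟨ε₀, hε₀, hεE, hsol⟩ := exists_periodic_solution (v := polarField F)
    (w := polarFieldDeriv F F₁) (c := -r₀ * c) (T := 2 * Real.pi) ha0 hE0 Real.two_pi_pos hv hw
    (fun ε hε θ r hr => hasDerivAt_polarField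
      (hF _ (mul_cos_mem_Ioo ((habs r hr).trans_lt (by linarith)) θ)) (hden ε hε θ r hr).ne')
    (fun ε θ r => by simp only [polarField, Real.cos_add_two_pi, Real.sin_add_two_pi])
    (by rw [hmean, h0, mul_zero])
    (by
      rw [funext hmean]
      refine ((hasDerivAt_id r₀).neg.mul h1).congr_deriv ?_
      simp [h0])
    (mul_ne_zero (neg_ne_zero.2 hr₀.ne') hc) (lt_min hη (half_pos ha0))
  refine ⟨a, ha0, by linarith, by linarith, ε₀, hε₀, fun ε hε hεε => ?_⟩
  obtain ⟨u, hup, hud, huη, -, hne⟩ := hsol ε hε hεε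
  have hεI : ε ∈ Icc 0 E := ⟨hε.le, hεε.trans hεE⟩
  refine ⟨hden ε hεI, ?_, u, hup, hud, fun θ => (huη θ).trans_le (min_le_left _ _),
    fun θ => (huη θ).trans_le (min_le_right _ _), hne⟩
  exact hw.comp (f := fun p : ℝ × ℝ => (ε, p.1, p.2)) (by fun_prop) fun p hp => ⟨hεI, hp⟩

/-- The averaged (Melnikov) function of a well of `g` with normalizing coordinate `ξ`. -/
noncomputable def melnikov (f : ℝ[X]) (ξ : ℝ → ℝ) (r : ℝ) : ℝ :=
  ∫ θ in (0 : ℝ)..2 * Real.pi,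
    f.eval (ξ (r * Real.cos θ)) * deriv ξ (r * Real.cos θ) * Real.sin θ ^ 2

/-- A coordinate `ξ` on `(-R, R)` turning the potential of `g` into `s ↦ s² / 2`. -/
structure IsWell (g : ℝ[X]) (ξ : ℝ → ℝ) (R : ℝ) : Prop where
  contDiffOn : ContDiffOn ℝ 2 ξ (Ioo (-R) R)
  deriv_pos : ∀ s ∈ Ioo (-R) R, 0 < deriv ξ s
  eval_mul_deriv : ∀ s ∈ Ioo (-R) R, g.eval (ξ s) * deriv ξ s = s

namespace IsWell

variable {g : ℝ[X]} {ξ : ℝ → ℝ} {R : ℝ}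

theorem hasDerivAt (h : IsWell g ξ R) {s : ℝ} (hs : s ∈ Ioo (-R) R) :
    HasDerivAt ξ (deriv ξ s) s :=
  ((h.contDiffOn.contDiffAt (isOpen_Ioo.mem_nhds hs)).differentiableAt two_ne_zero).hasDerivAt

theorem hasStrictDerivAt (h : IsWell g ξ R) {s : ℝ} (hs : s ∈ Ioo (-R) R) :
    HasStrictDerivAt ξ (deriv ξ s) s :=
  (h.contDiffOn.contDiffAt (isOpen_Ioo.mem_nhds hs)).hasStrictDerivAt two_ne_zero

theorem contDiffOn_deriv (h : IsWell g ξ R) : ContDiffOn ℝ 1 (deriv ξ) (Ioo (-R) R) :=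
  h.contDiffOn.deriv_of_isOpen isOpen_Ioo (by norm_num)

theorem hasDerivAt_deriv (h : IsWell g ξ R) {s : ℝ} (hs : s ∈ Ioo (-R) R) :
    HasDerivAt (deriv ξ) (deriv (deriv ξ) s) s :=
  ((h.contDiffOn_deriv.contDiffAt (isOpen_Ioo.mem_nhds hs)).differentiableAt one_ne_zero).hasDerivAt

theorem continuousOn_deriv_deriv (h : IsWell g ξ R) :
    ContinuousOn (deriv (deriv ξ)) (Ioo (-R) R) :=
  h.contDiffOn_deriv.continuousOn_deriv_of_isOpen isOpen_Ioo le_rfl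

theorem strictMonoOn (h : IsWell g ξ R) : StrictMonoOn ξ (Ioo (-R) R) :=
  strictMonoOn_of_deriv_pos (convex_Ioo _ _) h.contDiffOn.continuousOn
    (by rw [interior_Ioo]; exact h.deriv_pos)

theorem hasDerivAt_mul (h : IsWell g ξ R) (f : ℝ[X]) {s : ℝ} (hs : s ∈ Ioo (-R) R) :
    HasDerivAt (fun s => f.eval (ξ s) * deriv ξ s)
      (f.derivative.eval (ξ s) * deriv ξ s * deriv ξ s + f.eval (ξ s) * deriv (deriv ξ) s) s :=
  ((f.hasDerivAt (ξ s)).comp s (h.hasDerivAt hs)).mul (h.hasDerivAt_deriv hs)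

theorem continuousOn_mul_deriv (h : IsWell g ξ R) (f : ℝ[X]) :
    ContinuousOn (fun s => f.derivative.eval (ξ s) * deriv ξ s * deriv ξ s +
      f.eval (ξ s) * deriv (deriv ξ) s) (Ioo (-R) R) := by
  have h0 := h.contDiffOn.continuousOn
  have h1 := h.contDiffOn_deriv.continuousOn
  have h2 := h.continuousOn_deriv_deriv
  have h3 := f.continuous.comp_continuousOn h0
  have h4 := f.derivative.continuous.comp_continuousOn h0
  exact ((h4.mul h1).mul h1).add (h3.mul h2)

end IsWell

/-- Data producing a family of limit cycles of `lienard f g ε` whose projections to the first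
coordinate tend to `[A, B]` as `ε → 0`. -/
def IsDatum (f g : ℝ[X]) (A B : ℝ) : Prop :=
  ∃ ξ : ℝ → ℝ, ∃ R r₀ c : ℝ, IsWell g ξ R ∧ (∃ C, ∀ s ∈ Ioo (-R) R, |ξ s| < C) ∧ 0 < r₀ ∧ r₀ < R ∧
    ξ (-r₀) = A ∧ ξ r₀ = B ∧ melnikov f ξ r₀ = 0 ∧ HasDerivAt (melnikov f ξ) c r₀ ∧ c ≠ 0

/-- The invertible linear map of the plane with matrix `[[a, b], [c, d]]`. -/
theorem exists_continuousLinearEquiv {a b c d : ℝ} (h : a * d - b * c ≠ 0) :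
    ∃ e : (ℝ × ℝ) ≃L[ℝ] (ℝ × ℝ), (e : (ℝ × ℝ) →L[ℝ] (ℝ × ℝ)) =
      (a • ContinuousLinearMap.fst ℝ ℝ ℝ + b • ContinuousLinearMap.snd ℝ ℝ ℝ).prod
        (c • ContinuousLinearMap.fst ℝ ℝ ℝ + d • ContinuousLinearMap.snd ℝ ℝ ℝ) := by
  obtain ⟨D, hD⟩ : ∃ D, a * d - b * c = D := ⟨_, rfl⟩
  rw [hD] at h
  refine ⟨ContinuousLinearEquiv.equivOfInverse
    ((a • ContinuousLinearMap.fst ℝ ℝ ℝ + b • ContinuousLinearMap.snd ℝ ℝ ℝ).prod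
        (c • ContinuousLinearMap.fst ℝ ℝ ℝ + d • ContinuousLinearMap.snd ℝ ℝ ℝ))
    (((d / D) • ContinuousLinearMap.fst ℝ ℝ ℝ + (-b / D) • ContinuousLinearMap.snd ℝ ℝ ℝ).prod
        ((-c / D) • ContinuousLinearMap.fst ℝ ℝ ℝ + (a / D) • ContinuousLinearMap.snd ℝ ℝ ℝ))
    ?_ ?_, rfl⟩ <;>
  · rintro ⟨x, y⟩
    simp only [ContinuousLinearMap.prod_apply, add_apply,
      smul_apply, ContinuousLinearMap.coe_fst', ContinuousLinearMap.coe_snd',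
      smul_eq_mul, Prod.mk.injEq]
    constructor <;> field_simp
    · linear_combination x * hD
    · linear_combination y * hD

theorem contDiff_lienard (f g : ℝ[X]) (ε : ℝ) : ContDiff ℝ 1 (lienard f g ε) := by
  have hf : ContDiff ℝ 1 fun p : ℝ × ℝ => f.eval p.1 := (f.contDiff_aeval 1).comp contDiff_fst
  have hg : ContDiff ℝ 1 fun p : ℝ × ℝ => g.eval p.1 := (g.contDiff_aeval 1).comp contDiff_fst
  unfold lienard
  fun_prop

/-- Polar coordinates of a well. -/
noncomputable def wellPolar (ξ : ℝ → ℝ) (p : ℝ × ℝ) : ℝ × ℝ :=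
  (ξ (p.2 * Real.cos p.1), -(p.2 * Real.sin p.1))

theorem IsWell.exists_hasStrictFDerivAt_wellPolar {g : ℝ[X]} {ξ : ℝ → ℝ} {R : ℝ}
    (h : IsWell g ξ R) (f : ℝ[X]) (ε : ℝ) {p : ℝ × ℝ} (hp : 0 < p.2) (hpR : p.2 < R)
    (hden : 0 < 1 - ε * (f.eval (ξ (p.2 * Real.cos p.1)) * deriv ξ (p.2 * Real.cos p.1)) *
      (Real.sin p.1 * Real.cos p.1)) :
    ∃ e : (ℝ × ℝ) ≃L[ℝ] (ℝ × ℝ),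
      HasStrictFDerivAt (wellPolar ξ) (e : (ℝ × ℝ) →L[ℝ] (ℝ × ℝ)) p ∧
      e (1, ε * polarField (fun s => f.eval (ξ s) * deriv ξ s) ε p.1 p.2) =
        (deriv ξ (p.2 * Real.cos p.1) / (1 - ε * (f.eval (ξ (p.2 * Real.cos p.1)) *
          deriv ξ (p.2 * Real.cos p.1)) * (Real.sin p.1 * Real.cos p.1))) •
          lienard f g ε (wellPolar ξ p) := by
  have hs : p.2 * Real.cos p.1 ∈ Ioo (-R) R := mul_cos_mem_Ioo (by rwa [abs_of_pos hp]) _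
  have hX := h.deriv_pos _ hs
  have hg := h.eval_mul_deriv _ hs
  have hξ := h.hasStrictDerivAt hs
  have hsc := Real.sin_sq_add_cos_sq p.1
  set X := deriv ξ (p.2 * Real.cos p.1) with hXd
  have hdet : (X * (-(p.2 * Real.sin p.1))) * (-Real.sin p.1) -
      (X * Real.cos p.1) * (-(p.2 * Real.cos p.1)) ≠ 0 := by
    have : (X * (-(p.2 * Real.sin p.1))) * (-Real.sin p.1) -
      (X * Real.cos p.1) * (-(p.2 * Real.cos p.1)) = X * p.2 := by
      linear_combination X * p.2 * hsc
    rw [this]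
    positivity
  obtain ⟨e, he⟩ := exists_continuousLinearEquiv hdet
  refine ⟨e, ?_, ?_⟩
  · rw [he]
    have hcos : HasStrictFDerivAt (fun p : ℝ × ℝ => Real.cos p.1)
        ((-Real.sin p.1) • ContinuousLinearMap.fst ℝ ℝ ℝ) p :=
      (Real.hasStrictDerivAt_cos p.1).comp_hasStrictFDerivAt p hasStrictFDerivAt_fst
    have hsin : HasStrictFDerivAt (fun p : ℝ × ℝ => Real.sin p.1)
        ((Real.cos p.1) • ContinuousLinearMap.fst ℝ ℝ ℝ) p :=
      (Real.hasStrictDerivAt_sin p.1).comp_hasStrictFDerivAt p hasStrictFDerivAt_fst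
    have h2 : HasStrictFDerivAt (fun p : ℝ × ℝ => p.2) (ContinuousLinearMap.snd ℝ ℝ ℝ) p :=
      hasStrictFDerivAt_snd
    have hx := hξ.comp_hasStrictFDerivAt p (h2.mul hcos)
    have hy := (h2.mul hsin).neg
    refine (hx.prodMk hy).congr_fderiv ?_
    ext <;> simp
  · have : ∀ z, e z = (e : (ℝ × ℝ) →L[ℝ] (ℝ × ℝ)) z := fun _ => rfl
    rw [this, he]
    simp only [ContinuousLinearMap.prod_apply, add_apply,
      smul_apply, ContinuousLinearMap.coe_fst', ContinuousLinearMap.coe_snd',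
      smul_eq_mul, lienard, wellPolar, Prod.smul_mk, Prod.mk.injEq, polarField, ← hXd]
    set S := Real.sin p.1
    set c := Real.cos p.1
    set φ := f.eval (ξ (p.2 * c))
    set D := 1 - ε * (φ * X) * (S * c) with hD
    have hD0 : D * D⁻¹ = 1 := mul_inv_cancel₀ hden.ne'
    simp only [div_eq_mul_inv]
    set i := D⁻¹
    constructor
    · linear_combination (X * p.2 * S) * hD0 - (X * p.2 * S * i) * hD
    · linear_combination (p.2 * c) * hD0 + i * hg - (p.2 * c * i) * hD +
        (ε * φ * X * p.2 * S * i) * hsc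

theorem IsWell.wellPolar_injective {g : ℝ[X]} {ξ : ℝ → ℝ} {R : ℝ}
    (h : IsWell g ξ R) {p q : ℝ × ℝ} (hp : 0 < p.2) (hpR : p.2 < R) (hq : 0 < q.2) (hqR : q.2 < R)
    (hpq : wellPolar ξ p = wellPolar ξ q) :
    p.2 = q.2 ∧ ∃ k : ℤ, p.1 = q.1 + k * (2 * Real.pi) := by
  simp only [wellPolar, Prod.mk.injEq, neg_inj] at hpq
  obtain ⟨h1, h2⟩ := hpq
  have h3 := h.strictMonoOn.injOn (mul_cos_mem_Ioo (by rwa [abs_of_pos hp]) _)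
    (mul_cos_mem_Ioo (by rwa [abs_of_pos hq]) _) h1
  have h4 : p.2 ^ 2 = q.2 ^ 2 := by
    calc p.2 ^ 2 = (p.2 * Real.cos p.1) ^ 2 + (p.2 * Real.sin p.1) ^ 2 := by
          linear_combination -p.2 ^ 2 * Real.sin_sq_add_cos_sq p.1
      _ = q.2 ^ 2 := by
          rw [h3, h2]
          linear_combination q.2 ^ 2 * Real.sin_sq_add_cos_sq q.1
  have h5 : p.2 = q.2 := (pow_left_inj₀ hp.le hq.le two_ne_zero).1 h4
  refine ⟨h5, ?_⟩
  rw [h5] at h3 h2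
  obtain ⟨k, hk⟩ := Real.Angle.angle_eq_iff_two_pi_dvd_sub.1
    (Real.Angle.cos_sin_inj (mul_left_cancel₀ hq.ne' h3) (mul_left_cancel₀ hq.ne' h2))
  exact ⟨k, by linarith⟩

/-- Each datum produces limit cycles of `lienard f g ε` close to its well interval. -/
theorem IsDatum.exists_limitCycle {f g : ℝ[X]} {A B : ℝ} (hAB : IsDatum f g A B) {η : ℝ}
    (hη : 0 < η) :
    ∃ ε₀ > 0, ∀ ε, 0 < ε → ε ≤ ε₀ → ∃ Γ, IsLimitCycle (lienard f g ε) Γ ∧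
      (∀ p ∈ Γ, A - η < p.1 ∧ p.1 < B + η) ∧ (∃ p ∈ Γ, p.1 < A + η) ∧ ∃ p ∈ Γ, B - η < p.1 := by
  obtain ⟨ξ, R, r₀, c, h, -, hr₀, hR, rfl, rfl, h0, h1, hc⟩ := hAB
  have hr₀I : r₀ ∈ Ioo (-R) R := ⟨by linarith, hR⟩
  have hr₀I' : -r₀ ∈ Ioo (-R) R := ⟨by linarith, by linarith⟩
  obtain ⟨δ₁, hδ₁, hB⟩ := Metric.continuousAt_iff.1 (h.hasDerivAt hr₀I).continuousAt η hη
  obtain ⟨δ₂, hδ₂, hA⟩ := Metric.continuousAt_iff.1 (h.hasDerivAt hr₀I').continuousAt η hη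
  obtain ⟨a, ha, har, haR, ε₀, hε₀, hsol⟩ := exists_polar_periodic_solution hr₀ hR
    (fun s hs => h.hasDerivAt_mul f hs) (h.continuousOn_mul_deriv f) h0 h1 hc
    (lt_min hδ₁ hδ₂)
  refine ⟨ε₀, hε₀, fun ε hε hεε => ?_⟩
  obtain ⟨hden, hw, u, hup, hud, huη, hua, hne⟩ := hsol ε hε hεε
  set F : ℝ → ℝ := fun s => f.eval (ξ s) * deriv ξ s with hF
  set F₁ : ℝ → ℝ := fun s => f.derivative.eval (ξ s) * deriv ξ s * deriv ξ s +
    f.eval (ξ s) * deriv (deriv ξ) s with hF₁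
  have hpos : ∀ r ∈ Icc (r₀ - a) (r₀ + a), 0 < r ∧ r < R := fun r hr =>
    ⟨by linarith [hr.1], by linarith [hr.2]⟩
  have hmem : ∀ r ∈ Icc (r₀ - a) (r₀ + a), ∀ θ, r * Real.cos θ ∈ Ioo (-R) R := fun r hr =>
    mul_cos_mem_Ioo (by rw [abs_of_pos (hpos r hr).1]; exact (hpos r hr).2)
  have hcomp : ∀ {q : ℝ → ℝ}, ContinuousOn q (Ioo (-R) R) →
      ContinuousOn (fun p : ℝ × ℝ => q (p.2 * Real.cos p.1)) (univ ×ˢ Icc (r₀ - a) (r₀ + a)) :=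
    fun hq => hq.comp (by fun_prop) fun p hp => hmem _ hp.2 _
  have hcX := hcomp h.contDiffOn_deriv.continuousOn
  have hcF : ContinuousOn (fun p : ℝ × ℝ => F (p.2 * Real.cos p.1))
      (univ ×ˢ Icc (r₀ - a) (r₀ + a)) :=
    hcomp ((f.continuous.comp_continuousOn h.contDiffOn.continuousOn).mul
      h.contDiffOn_deriv.continuousOn)
  choose! Φ' hΦ hVΦ using fun (p : ℝ × ℝ) (hp : p.2 ∈ Ioo (r₀ - a) (r₀ + a)) =>
    h.exists_hasStrictFDerivAt_wellPolar f ε (hpos _ (Ioo_subset_Icc_self hp)).1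
      (hpos _ (Ioo_subset_Icc_self hp)).2 (hden p.1 _ (Ioo_subset_Icc_self hp))
  have huI : ∀ θ, u θ ∈ Icc (r₀ - a) (r₀ + a) := fun θ => by
    have := abs_lt.1 (hua θ); exact ⟨by linarith, by linarith⟩
  refine ⟨range fun θ => wellPolar ξ (θ, u θ), ?_, ?_, ?_, ?_⟩
  · refine isLimitCycle_of_coordinates (contDiff_lienard f g ε) (Φ := wellPolar ξ) (Φ' := Φ')
      (h := fun θ r => ε * polarField F ε θ r) (w := fun θ r => ε * polarFieldDeriv F F₁ ε θ r)
      (ω := fun p => deriv ξ (p.2 * Real.cos p.1) /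
        (1 - ε * F (p.2 * Real.cos p.1) * (Real.sin p.1 * Real.cos p.1)))
      ha Real.two_pi_pos hΦ ?_ ?_ ?_ ?_ ?_ hVΦ (continuousOn_const.mul hw) ?_ ?_ ?_ hup hua hud ?_
    · intro θ r
      simp only [wellPolar, Real.cos_add_two_pi, Real.sin_add_two_pi]
    · intro p q hp hq hpq
      have hp' := hpos _ (Ioo_subset_Icc_self hp)
      have hq' := hpos _ (Ioo_subset_Icc_self hq)
      exact h.wellPolar_injective hp'.1 hp'.2 hq'.1 hq'.2 hpq
    · exact hcX.div (continuousOn_const.sub ((continuousOn_const.mul hcF).mul (by fun_prop)))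
        fun p hp => (hden p.1 _ hp.2).ne'
    · exact fun p hp => div_pos (h.deriv_pos _ (hmem _ (Ioo_subset_Icc_self hp) _))
        (hden p.1 _ (Ioo_subset_Icc_self hp))
    · intro θ r
      simp only [Real.cos_add_two_pi, Real.sin_add_two_pi]
    · exact fun θ r hr => (hasDerivAt_polarField (h.hasDerivAt_mul f (hmem r hr θ))
        (hden θ r hr).ne').const_mul ε
    · intro θ r
      simp only [polarField, Real.cos_add_two_pi, Real.sin_add_two_pi]
    · intro θ r
      simp only [polarFieldDeriv, Real.cos_add_two_pi, Real.sin_add_two_pi]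
    · rw [intervalIntegral.integral_const_mul]
      exact mul_ne_zero hε.ne' hne
  · rintro _ ⟨θ, rfl⟩
    simp only [wellPolar]
    have hx := hmem _ (huI θ) θ
    have hx2 := abs_le.1 (abs_mul_cos_le (r := u θ) le_rfl θ)
    rw [abs_of_pos (hpos _ (huI θ)).1] at hx2
    have hu1 : u θ ∈ Ioo (-R) R := by simpa using (hmem _ (huI θ) 0)
    have hu2 : -u θ ∈ Ioo (-R) R := by simpa using (hmem _ (huI θ) Real.pi)
    have h3 := hA (x := -u θ) (by
      rw [Real.dist_eq, neg_sub_neg, abs_sub_comm]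
      exact (huη θ).trans_le (min_le_right _ _))
    have h4 := hB (x := u θ) ((huη θ).trans_le (min_le_left _ _))
    rw [Real.dist_eq, abs_lt] at h3 h4
    have h5 := h.strictMonoOn.monotoneOn hx hu1 hx2.2
    have h6 := h.strictMonoOn.monotoneOn hu2 hx hx2.1
    exact ⟨by linarith, by linarith⟩
  · refine ⟨_, mem_range_self Real.pi, ?_⟩
    have h3 := hA (x := -u Real.pi) (by
      rw [Real.dist_eq, neg_sub_neg, abs_sub_comm]
      exact (huη Real.pi).trans_le (min_le_right _ _))
    rw [Real.dist_eq, abs_lt] at h3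
    simp only [wellPolar, Real.cos_pi, mul_neg, mul_one]
    linarith
  · refine ⟨_, mem_range_self 0, ?_⟩
    have h4 := hB (x := u 0) ((huη 0).trans_le (min_le_left _ _))
    rw [Real.dist_eq, abs_lt] at h4
    simp only [wellPolar, Real.cos_zero, mul_one]
    linarith

theorem Finset.exists_pos_forall_le {ι : Type*} (s : Finset ι) {f : ι → ℝ}
    (h : ∀ i ∈ s, 0 < f i) : ∃ ε > 0, ∀ i ∈ s, ε ≤ f i := by
  rcases s.eq_empty_or_nonempty with rfl | hne
  · exact ⟨1, one_pos, by simp⟩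
  · exact ⟨s.inf' hne f, (Finset.lt_inf'_iff hne).2 h, fun i hi => Finset.inf'_le f hi⟩

/-- Pairwise distinct data produce pairwise distinct limit cycles. -/
theorem hGe_of_isDatum {f g : ℝ[X]} {n m : ℕ} (hf : f.natDegree ≤ n) (hg : g.natDegree ≤ m)
    (T : Finset (ℝ × ℝ)) (hT : ∀ q ∈ T, IsDatum f g q.1 q.2) {c : ℝ} (hc : c ≤ T.card) :
    HGe n m c := by
  obtain ⟨η, hη, hsep⟩ : ∃ η > 0, ∀ q ∈ T, ∀ q' ∈ T, q ≠ q' → 2 * η ≤ dist q q' := by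
    obtain ⟨η, hη, h⟩ := T.offDiag.exists_pos_forall_le (f := fun q => dist q.1 q.2)
      (fun q hq => dist_pos.2 (Finset.mem_offDiag.1 hq).2.2)
    exact ⟨η / 2, half_pos hη, fun q hq q' hq' hne => by
      linarith [h (q, q') (Finset.mem_offDiag.2 ⟨hq, hq', hne⟩)]⟩
  choose! e he hcyc using fun q hq => (hT q hq).exists_limitCycle hη
  obtain ⟨ε₀, hε₀, hle⟩ := T.exists_pos_forall_le he
  refine ⟨f, g, hf, hg, ε₀, hε₀, fun ε hε hεε => ?_⟩
  choose! Γ hΓ hΓ1 hΓ2 hΓ3 using fun q hq => hcyc q hq ε hε (hεε.trans (hle q hq))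
  classical
  refine ⟨T.image Γ, Finset.forall_mem_image.2 hΓ, hc.trans ?_⟩
  rw [Finset.card_image_of_injOn]
  intro q hq q' hq' heq
  by_contra hne
  have key : ∀ q ∈ T, ∀ q' ∈ T, Γ q = Γ q' → q.1 < q'.1 + 2 * η ∧ q'.2 < q.2 + 2 * η := by
    intro q hq q' hq' h
    obtain ⟨x, hx, hx'⟩ := hΓ2 q' hq'
    obtain ⟨y, hy, hy'⟩ := hΓ3 q' hq'
    rw [← h] at hx hy
    exact ⟨by linarith [(hΓ1 q hq x hx).1], by linarith [(hΓ1 q hq y hy).2]⟩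
  have h1 := key q hq q' hq' heq
  have h2 := key q' hq' q hq heq.symm
  have h3 := hsep q hq q' hq' hne
  rw [Prod.dist_eq, Real.dist_eq, Real.dist_eq, le_max_iff] at h3
  rcases h3 with h3 | h3
  · have : |q.1 - q'.1| < 2 * η := abs_lt.2 ⟨by linarith, by linarith⟩
    linarith
  · have : |q.2 - q'.2| < 2 * η := abs_lt.2 ⟨by linarith, by linarith⟩
    linarith

namespace IsWell

variable {g : ℝ[X]} {ξ : ℝ → ℝ} {R : ℝ}

theorem continuousOn_eval_mul (h : IsWell g ξ R) (f : ℝ[X]) :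
    ContinuousOn (fun s => f.eval (ξ s) * deriv ξ s) (Ioo (-R) R) :=
  (f.continuous.comp_continuousOn h.contDiffOn.continuousOn).mul h.contDiffOn_deriv.continuousOn

theorem continuous_eval_mul_cos (h : IsWell g ξ R) (f : ℝ[X]) {r : ℝ} (hr : |r| < R) :
    Continuous fun θ =>
      f.eval (ξ (r * Real.cos θ)) * deriv ξ (r * Real.cos θ) * Real.sin θ ^ 2 := by
  have : Continuous fun θ => f.eval (ξ (r * Real.cos θ)) * deriv ξ (r * Real.cos θ) :=
    (h.continuousOn_eval_mul f).comp_continuous (by fun_prop) (mul_cos_mem_Ioo hr)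
  fun_prop

theorem melnikov_add_smul (h : IsWell g ξ R) (f e : ℝ[X]) (δ : ℝ) {r : ℝ} (hr : |r| < R) :
    melnikov (f + C δ * e) ξ r = melnikov f ξ r + δ * melnikov e ξ r := by
  unfold melnikov
  rw [← intervalIntegral.integral_const_mul, ← intervalIntegral.integral_add
    ((h.continuous_eval_mul_cos f hr).intervalIntegrable _ _)
    (((h.continuous_eval_mul_cos e hr).const_mul δ).intervalIntegrable _ _)]
  congr 1
  ext θ
  simp only [eval_add, eval_mul, eval_C]
  ring

/-- The radial derivative of the averaged function. -/
theorem exists_hasDerivAt_melnikov (h : IsWell g ξ R) (f : ℝ[X]) :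
    ∃ M' : ℝ → ℝ, ContinuousOn M' (Ioo (-R) R) ∧
      ∀ r ∈ Ioo (-R) R, HasDerivAt (melnikov f ξ) (M' r) r := by
  have hmap : MapsTo (fun p : ℝ × ℝ => p.1 * Real.cos p.2) (Ioo (-R) R ×ˢ univ) (Ioo (-R) R) :=
    fun p hp => mul_cos_mem_Ioo (abs_lt.2 hp.1) _
  have hc₁ := (h.continuousOn_mul_deriv f).comp (f := fun p : ℝ × ℝ => p.1 * Real.cos p.2)
    (by fun_prop) hmap
  have hc := (h.continuousOn_eval_mul f).comp (f := fun p : ℝ × ℝ => p.1 * Real.cos p.2)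
    (by fun_prop) hmap
  set F₁ : ℝ → ℝ := fun s => f.derivative.eval (ξ s) * deriv ξ s * deriv ξ s +
    f.eval (ξ s) * deriv (deriv ξ) s with hF₁
  have hcont : ContinuousOn (Function.uncurry fun r θ : ℝ =>
      F₁ (r * Real.cos θ) * Real.cos θ * Real.sin θ ^ 2) (Ioo (-R) R ×ˢ univ) :=
    (hc₁.mul (Continuous.continuousOn (by fun_prop))).mul (Continuous.continuousOn (by fun_prop))
  have hcont₀ : ContinuousOn (Function.uncurry fun r θ : ℝ =>
      f.eval (ξ (r * Real.cos θ)) * deriv ξ (r * Real.cos θ) * Real.sin θ ^ 2)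
      (Ioo (-R) R ×ˢ univ) :=
    hc.mul (Continuous.continuousOn (by fun_prop))
  refine ⟨fun r => ∫ θ in (0 : ℝ)..2 * Real.pi,
    F₁ (r * Real.cos θ) * Real.cos θ * Real.sin θ ^ 2, continuousOn_intervalIntegral hcont _ _,
    fun r hr => ?_⟩
  refine hasDerivAt_intervalIntegral_param isOpen_Ioo hcont₀ hcont (fun r hr θ => ?_) 0 (2 * Real.pi)
    hr
  have h1 : HasDerivAt (fun r => r * Real.cos θ) (Real.cos θ) r := by
    simpa using (hasDerivAt_id r).mul_const (Real.cos θ)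
  exact ((h.hasDerivAt_mul f (mul_cos_mem_Ioo (abs_lt.2 hr) θ)).comp r h1).mul_const _

theorem deriv_reflect (h : IsWell g ξ R) {s : ℝ} (hs : s ∈ Ioo (-R) R) :
    deriv (fun s => -ξ (-s)) s = deriv ξ (-s) := by
  have h1 : HasDerivAt (fun s => ξ (-s)) (deriv ξ (-s) * -1) s :=
    (h.hasDerivAt (s := -s) ⟨by linarith [hs.2], by linarith [hs.1]⟩).comp s (hasDerivAt_neg s)
  exact (h1.neg.congr_deriv (by ring)).deriv

/-- Shifting `θ` by `π` shows that odd friction has opposite averages over mirrored wells. -/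
theorem melnikov_reflect (h : IsWell g ξ R) {ξ₂ : ℝ → ℝ} {f : ℝ[X]}
    (hf : ∀ x, f.eval (-x) = -f.eval x) (hξ : ∀ s ∈ Ioo (-R) R, ξ₂ s = -ξ (-s)) {r : ℝ}
    (hr : |r| < R) : melnikov f ξ₂ r = -melnikov f ξ r := by
  have hper : Function.Periodic (fun θ => f.eval (ξ (r * Real.cos θ)) *
      deriv ξ (r * Real.cos θ) * Real.sin θ ^ 2) (2 * Real.pi) := fun θ => by
    simp only [Real.cos_add_two_pi, Real.sin_add_two_pi]
  have hd : ∀ s ∈ Ioo (-R) R, deriv ξ₂ s = deriv ξ (-s) := fun s hs => by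
    have : ξ₂ =ᶠ[𝓝 s] fun s => -ξ (-s) := by
      filter_upwards [isOpen_Ioo.mem_nhds hs] with x hx using hξ x hx
    rw [this.deriv_eq]
    exact h.deriv_reflect hs
  have h1 : melnikov f ξ₂ r = ∫ θ in (0 : ℝ)..2 * Real.pi,
      -(f.eval (ξ (r * Real.cos (θ + Real.pi))) *
      deriv ξ (r * Real.cos (θ + Real.pi)) * Real.sin (θ + Real.pi) ^ 2) := by
    unfold melnikov
    congr 1
    ext θ
    have hs := mul_cos_mem_Ioo hr θ
    rw [hξ _ hs, hd _ hs, hf, Real.cos_add_pi, Real.sin_add_pi, mul_neg, neg_sq]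
    ring
  rw [h1, intervalIntegral.integral_neg, intervalIntegral.integral_comp_add_right
    (fun θ => f.eval (ξ (r * Real.cos θ)) * deriv ξ (r * Real.cos θ) * Real.sin θ ^ 2) Real.pi]
  have h2 := hper.intervalIntegral_add_eq (0 + Real.pi) 0
  rw [show 0 + Real.pi + 2 * Real.pi = 2 * Real.pi + Real.pi by ring, zero_add (2 * Real.pi)] at h2
  rw [h2, melnikov]

/-- The well of an odd polynomial mirrored at the origin. -/
theorem reflect (h : IsWell g ξ R) (hg : ∀ x, g.eval (-x) = -g.eval x) :
    IsWell g (fun s => -ξ (-s)) R := by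
  have hneg : ∀ s ∈ Ioo (-R) R, -s ∈ Ioo (-R) R := fun s hs =>
    ⟨by linarith [hs.2], by linarith [hs.1]⟩
  have hd : ∀ s ∈ Ioo (-R) R, deriv (fun s => -ξ (-s)) s = deriv ξ (-s) := fun s hs =>
    h.deriv_reflect hs
  refine ⟨(h.contDiffOn.comp contDiff_neg.contDiffOn hneg).neg, fun s hs => ?_, fun s hs => ?_⟩
  · rw [hd s hs]
    exact h.deriv_pos _ (hneg s hs)
  · rw [hd s hs, hg, neg_mul, h.eval_mul_deriv _ (hneg s hs), neg_neg]

end IsWell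

/-- The pullback of the one-form `q(x) dx` under `x = u ^ 2 - a`. -/
noncomputable def pullback (a : ℝ) (q : ℝ[X]) : ℝ[X] :=
  q.comp (X ^ 2 - C a) * (C 2 * X)

theorem eval_pullback (a : ℝ) (q : ℝ[X]) (u : ℝ) :
    (pullback a q).eval u = q.eval (u ^ 2 - a) * (2 * u) := by
  simp [pullback]

theorem eval_pullback_neg (a : ℝ) (q : ℝ[X]) (u : ℝ) :
    (pullback a q).eval (-u) = -(pullback a q).eval u := by
  rw [eval_pullback, eval_pullback, neg_sq]
  ring

theorem natDegree_pullback_le (a : ℝ) (q : ℝ[X]) :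
    (pullback a q).natDegree ≤ 2 * q.natDegree + 1 := by
  refine natDegree_mul_le.trans (add_le_add ?_ ((natDegree_C_mul_le _ _).trans natDegree_X_le))
  rw [natDegree_comp, natDegree_X_pow_sub_C, mul_comm]

theorem IsWell.pullback {g : ℝ[X]} {ξ : ℝ → ℝ} {R a : ℝ} (h : IsWell g ξ R)
    (ha : ∀ s ∈ Ioo (-R) R, 0 < ξ s + a) :
    IsWell (pullback a g) (fun s => √(ξ s + a)) R ∧
      ∀ s ∈ Ioo (-R) R, ∀ q : ℝ[X], (_root_.pullback a q).eval √(ξ s + a) *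
        deriv (fun s => √(ξ s + a)) s = q.eval (ξ s) * deriv ξ s := by
  have hd : ∀ s ∈ Ioo (-R) R, deriv (fun s => √(ξ s + a)) s = deriv ξ s / (2 * √(ξ s + a)) :=
    fun s hs => (((h.hasDerivAt hs).add_const a).sqrt (ha s hs).ne').deriv
  have heval : ∀ s ∈ Ioo (-R) R, ∀ q : ℝ[X], (_root_.pullback a q).eval √(ξ s + a) *
      deriv (fun s => √(ξ s + a)) s = q.eval (ξ s) * deriv ξ s := fun s hs q => by
    have := Real.sqrt_pos.2 (ha s hs)
    rw [hd s hs, eval_pullback, Real.sq_sqrt (ha s hs).le, add_sub_cancel_right]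
    field_simp
  refine ⟨⟨?_, fun s hs => ?_, fun s hs => ?_⟩, heval⟩
  · exact (h.contDiffOn.add contDiffOn_const).sqrt fun s hs => (ha s hs).ne'
  · rw [hd s hs]
    have := h.deriv_pos s hs
    have := Real.sqrt_pos.2 (ha s hs)
    positivity
  · rw [heval s hs, h.eval_mul_deriv s hs]

/-- Each datum lifts to two mirrored data under the double cover `x = u ^ 2 - a`. -/
theorem IsDatum.pullback {f g : ℝ[X]} {A B : ℝ} (h : IsDatum f g A B) :
    ∃ K, ∀ a, K ≤ a → 0 < A + a ∧ 0 < B + a ∧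
      IsDatum (pullback a f) (pullback a g) √(A + a) √(B + a) ∧
      IsDatum (_root_.pullback a f) (_root_.pullback a g) (-√(B + a)) (-√(A + a)) := by
  obtain ⟨ξ, R, r₀, c, hw, ⟨K, hK⟩, hr₀, hR, rfl, rfl, h0, h1, hc⟩ := h
  refine ⟨K, fun a ha => ?_⟩
  have hpos : ∀ s ∈ Ioo (-R) R, 0 < ξ s + a := fun s hs => by
    linarith [(abs_lt.1 (hK s hs)).1]
  obtain ⟨hw₁, heval⟩ := hw.pullback hpos
  have hw₂ := hw₁.reflect (eval_pullback_neg a g)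
  have hbd : ∀ s ∈ Ioo (-R) R, |√(ξ s + a)| < √(K + a) := fun s hs => by
    rw [abs_of_nonneg (Real.sqrt_nonneg _)]
    exact Real.sqrt_lt_sqrt (hpos s hs).le (by linarith [(abs_lt.1 (hK s hs)).2])
  have hm₁ : ∀ r, |r| < R → melnikov (_root_.pullback a f) (fun s => √(ξ s + a)) r =
      melnikov f ξ r := fun r hr => by
    unfold melnikov
    congr 1
    ext θ
    rw [heval _ (mul_cos_mem_Ioo hr θ)]
  have hm₂ : ∀ r, |r| < R → melnikov (_root_.pullback a f) (fun s => -√(ξ (-s) + a)) r =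
      -melnikov f ξ r := fun r hr => by
    rw [← hm₁ r hr]
    exact hw₁.melnikov_reflect (eval_pullback_neg a f) (fun s _ => rfl) hr
  have hr₀R : |r₀| < R := by rwa [abs_of_pos hr₀]
  have hev : ∀ᶠ r in 𝓝 r₀, |r| < R := continuous_abs.continuousAt.eventually_lt_const hr₀R
  refine ⟨hpos _ ⟨by linarith, by linarith⟩, hpos _ ⟨by linarith, by linarith⟩,
    ⟨_, R, r₀, c, hw₁, ⟨_, hbd⟩, hr₀, hR, rfl, rfl, ?_, ?_, hc⟩,
    ⟨_, R, r₀, -c, hw₂, ⟨√(K + a), fun s hs => ?_⟩, hr₀, hR, ?_, ?_, ?_, ?_, neg_ne_zero.2 hc⟩⟩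
  · rw [hm₁ _ hr₀R, h0]
  · exact h1.congr_of_eventuallyEq (hev.mono hm₁)
  · rw [abs_neg]
    exact hbd _ ⟨by linarith [hs.2], by linarith [hs.1]⟩
  · simp
  · simp
  · rw [hm₂ _ hr₀R, h0, neg_zero]
  · exact h1.neg.congr_of_eventuallyEq (hev.mono hm₂)

/-- Data persist under small perturbations of the friction. -/
theorem IsDatum.eventually_add_smul {f g : ℝ[X]} {A B : ℝ} (h : IsDatum f g A B) (e : ℝ[X])
    {η : ℝ} (hη : 0 < η) : ∀ᶠ δ in 𝓝 (0 : ℝ), ∃ A' B', |A' - A| < η ∧ |B' - B| < η ∧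
      IsDatum (f + C δ * e) g A' B' := by
  obtain ⟨ξ, R, r₀, c, hw, hK, hr₀, hR, rfl, rfl, h0, h1, hc⟩ := h
  obtain ⟨M, hMc, hM⟩ := hw.exists_hasDerivAt_melnikov f
  obtain ⟨P, hPc, hP⟩ := hw.exists_hasDerivAt_melnikov e
  have hsub : ∀ r ∈ Ioo 0 R, r ∈ Ioo (-R) R := fun r hr => ⟨by linarith [hr.1, hr.2], hr.2⟩
  have hr₀' : r₀ ∈ Ioo (-R) R := hsub _ ⟨hr₀, hR⟩
  have hr₀n : -r₀ ∈ Ioo (-R) R := ⟨by linarith, by linarith⟩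
  have hlab : ∀ᶠ r in 𝓝 r₀, |ξ (-r) - ξ (-r₀)| < η ∧ |ξ r - ξ r₀| < η := by
    have c1 : ContinuousAt (fun r => ξ (-r)) r₀ :=
      ContinuousAt.comp (f := fun r : ℝ => -r) (hw.hasDerivAt hr₀n).continuousAt
        continuousAt_neg
    have c2 : ContinuousAt ξ r₀ := (hw.hasDerivAt hr₀').continuousAt
    exact (c1.eventually (Metric.ball_mem_nhds _ hη)).and
      (c2.eventually (Metric.ball_mem_nhds _ hη))
  obtain ⟨κ, hκ, hκs⟩ := Metric.eventually_nhds_iff.1 hlab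
  have hmap : MapsTo (fun p : ℝ × ℝ => p.2) (univ ×ˢ Ioo 0 R) (Ioo (-R) R) :=
    fun p hp => hsub _ hp.2
  have hcomp : ∀ {F : ℝ → ℝ}, ContinuousOn F (Ioo (-R) R) →
      ContinuousOn (fun p : ℝ × ℝ => F p.2) (univ ×ˢ Ioo 0 R) := fun hF =>
    hF.comp continuous_snd.continuousOn hmap
  have hMd : ContinuousOn (melnikov f ξ) (Ioo (-R) R) := fun r hr =>
    (hM r hr).continuousAt.continuousWithinAt
  have hPd : ContinuousOn (melnikov e ξ) (Ioo (-R) R) := fun r hr =>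
    (hP r hr).continuousAt.continuousWithinAt
  have key := eventually_exists_simple_zero
    (Q := fun δ r => melnikov f ξ r + δ * melnikov e ξ r) (Q' := fun δ r => M r + δ * P r)
    (isOpen_univ.prod isOpen_Ioo)
    ((hcomp hMd).add (continuous_fst.continuousOn.mul (hcomp hPd)))
    ((hcomp hMc).add (continuous_fst.continuousOn.mul (hcomp hPc)))
    (fun p hp => (hM _ (hmap hp)).add ((hP _ (hmap hp)).const_mul p.1))
    (r₀ := r₀) ⟨mem_univ _, hr₀, hR⟩ (by simp [h0])
    (by simpa [(hM r₀ hr₀').unique h1] using hc) hκ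
  filter_upwards [key] with δ ⟨r, hr, ⟨_, hrR⟩, hz, hz'⟩
  have hr' := hsub r hrR
  refine ⟨ξ (-r), ξ r, (hκs hr).1, (hκs hr).2, ξ, R, r, _, hw, hK, hrR.1, hrR.2, rfl, rfl,
    ?_, ?_, hz'⟩
  · rw [hw.melnikov_add_smul f e δ (abs_lt.2 hr'), hz]
  · refine ((hM _ hr').add ((hP _ hr').const_mul δ)).congr_of_eventuallyEq ?_
    filter_upwards [isOpen_Ioo.mem_nhds hr'] with x hx
    exact hw.melnikov_add_smul f e δ (abs_lt.2 hx)

/-- Finitely many data persist simultaneously, with labels staying in a given open set. -/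
theorem eventually_exists_isDatum_add_smul {f g : ℝ[X]} (T : Finset (ℝ × ℝ))
    (hT : ∀ q ∈ T, IsDatum f g q.1 q.2) {U : Set (ℝ × ℝ)} (hU : IsOpen U) (hTU : ↑T ⊆ U)
    (e : ℝ[X]) : ∀ᶠ δ in 𝓝 (0 : ℝ), ∃ T' : Finset (ℝ × ℝ), T'.card = T.card ∧
      ∀ q ∈ T', q ∈ U ∧ IsDatum (f + C δ * e) g q.1 q.2 := by
  have hsep : ∃ V : ℝ × ℝ → Set (ℝ × ℝ), (∀ q, q ∈ V q ∧ IsOpen (V q)) ∧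
      (T : Set (ℝ × ℝ)).PairwiseDisjoint V := T.finite_toSet.t2_separation
  obtain ⟨V, hV, hdisj⟩ := hsep
  have hev : ∀ᶠ δ in 𝓝 (0 : ℝ), ∀ q ∈ T, ∃ q', q' ∈ V q ∧ q' ∈ U ∧
      IsDatum (f + C δ * e) g q'.1 q'.2 := by
    refine (eventually_all_finset T).2 fun q hq => ?_
    obtain ⟨η, hη, hb⟩ := Metric.isOpen_iff.1 ((hV q).2.inter hU) q ⟨(hV q).1, hTU hq⟩
    filter_upwards [(hT q hq).eventually_add_smul e hη] with δ ⟨A', B', hA, hB, hd⟩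
    have : (A', B') ∈ V q ∩ U := hb (by
      rw [Metric.mem_ball, Prod.dist_eq, max_lt_iff]
      exact ⟨hA, hB⟩)
    exact ⟨(A', B'), this.1, this.2, hd⟩
  filter_upwards [hev] with δ hδ
  choose! φ hφ using hδ
  refine ⟨T.image φ, Finset.card_image_of_injOn fun q hq q' hq' heq => ?_, fun q hq => ?_⟩
  · by_contra hne
    exact Set.disjoint_left.1 (hdisj hq hq' hne) (hφ q hq).1 (heq ▸ (hφ q' hq').1)
  · obtain ⟨q', hq', rfl⟩ := Finset.mem_image.1 hq
    exact (hφ q' hq').2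

theorem Polynomial.exists_derivative_X_mul_eq (p : ℝ[X]) :
    ∃ q : ℝ[X], derivative (X * q) = p := by
  induction p using Polynomial.induction_on' with
  | add p q hp hq =>
    obtain ⟨P, rfl⟩ := hp
    obtain ⟨Q, rfl⟩ := hq
    exact ⟨P + Q, by rw [mul_add, derivative_add]⟩
  | monomial n c =>
    refine ⟨monomial n (c / (n + 1)), ?_⟩
    rw [X_mul_monomial, derivative_monomial]
    congr 1
    push_cast
    field_simp

/-- A local inverse at the origin of a function of class `C²` on the line. -/
theorem ContDiffAt.exists_local_inverse_zero {S : ℝ → ℝ} {c : ℝ} (hS : ContDiffAt ℝ 2 S 0)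
    (h0 : S 0 = 0) (hd : HasDerivAt S c 0) (hc : c ≠ 0) :
    ∃ ξ : ℝ → ℝ, ContDiffAt ℝ 2 ξ 0 ∧ ξ 0 = 0 ∧ (∀ᶠ s in 𝓝 0, S (ξ s) = s) ∧
      ∀ᶠ u in 𝓝 0, ξ (S u) = u := by
  have hf' := hd.hasFDerivAt_equiv hc
  have hstrict := hS.hasStrictFDerivAt' hf' two_ne_zero
  have h1 := hS.to_localInverse hf' two_ne_zero
  have h2 := hS.localInverse_apply_image hf' two_ne_zero
  have h3 := hstrict.eventually_right_inverse
  rw [h0] at h1 h2 h3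
  exact ⟨_, h1, h2, h3, hstrict.eventually_left_inverse⟩

/-- The double cover `x = u ^ 2 - a` creates a symmetric well at the branch point. -/
theorem exists_isWell_pullback {g : ℝ[X]} {a : ℝ} (hg : 0 < g.eval (-a)) :
    ∃ ξ R, 0 < R ∧ IsWell (pullback a g) ξ R ∧ (∃ K, ∀ s ∈ Ioo (-R) R, |ξ s| < K) ∧
      ∀ s ∈ Ioo (-R) R, ξ (-s) = -ξ s := by
  obtain ⟨Q, hQ⟩ := exists_derivative_X_mul_eq (g.comp (X - C a))
  have hQ0 : 0 < Q.eval 0 := by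
    have := congrArg (Polynomial.eval 0) hQ
    simp at this
    linarith
  set S : ℝ → ℝ := fun u => u * √(2 * Q.eval (u ^ 2)) with hSdef
  have hS : ContDiffAt ℝ 2 S 0 := by
    refine contDiffAt_id.mul (ContDiffAt.sqrt ?_ (by simpa using hQ0.ne'))
    exact contDiffAt_const.mul (((contDiff_aeval (𝕜 := ℝ) Q _).comp (contDiff_id.pow 2)).contDiffAt)
  have hS0 : S 0 = 0 := by simp [hSdef]
  have hsq : 0 < √(2 * Q.eval 0) := Real.sqrt_pos.2 (by linarith)
  have hSd : HasDerivAt S √(2 * Q.eval 0) 0 := by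
    rw [hasDerivAt_iff_tendsto_slope]
    have hc : ContinuousAt (fun u : ℝ => √(2 * Q.eval (u ^ 2))) 0 := by fun_prop
    have := hc.tendsto.mono_left (nhdsWithin_le_nhds (s := {0}ᶜ))
    simp only [ne_eq, OfNat.ofNat_ne_zero, not_false_eq_true, zero_pow] at this
    refine this.congr' ?_
    filter_upwards [self_mem_nhdsWithin] with u hu
    have hu : u ≠ 0 := hu
    rw [slope_def_field, hS0, hSdef]
    field_simp
    ring
  obtain ⟨ξ, hξ, hξ0, hr, hl⟩ := hS.exists_local_inverse_zero hS0 hSd hsq.ne'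
  have hξt : Tendsto ξ (𝓝 0) (𝓝 0) := by
    have := hξ.continuousAt.tendsto
    rwa [hξ0] at this
  have hSodd : ∀ u, S (-u) = -S u := fun u => by simp [hSdef]
  have hodd : ∀ᶠ s in 𝓝 0, ξ (-s) = -ξ s := by
    have hneg : Tendsto (fun s => -ξ s) (𝓝 0) (𝓝 0) := by simpa using hξt.neg
    filter_upwards [hr, hneg.eventually hl] with s h1 h2
    rw [hSodd, h1] at h2
    exact h2
  have hpos : ∀ᶠ s in 𝓝 0, 0 < deriv ξ s := by
    have h1 : ContinuousAt (deriv ξ) 0 := (hξ.derivWithin (m := 1) (by norm_num)).continuousAt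
    refine h1.eventually (lt_mem_nhds ?_)
    have h2 : HasDerivAt ξ (deriv ξ 0) (S 0) := by
      rw [hS0]
      exact (hξ.differentiableAt two_ne_zero).hasDerivAt
    have h3 : HasDerivAt (fun u : ℝ => u) (deriv ξ 0 * √(2 * Q.eval 0)) 0 :=
      (h2.comp 0 hSd).congr_of_eventuallyEq (hl.mono fun u hu => hu.symm)
    have h4 := h3.unique (hasDerivAt_id' 0)
    exact pos_of_mul_pos_left (by rw [h4]; exact one_pos) hsq.le
  have hQpos : ∀ᶠ s in 𝓝 0, 0 < Q.eval (ξ s ^ 2) := by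
    have : ContinuousAt (fun u : ℝ => Q.eval (u ^ 2)) 0 := by fun_prop
    exact hξt.eventually (this.eventually (lt_mem_nhds (by simpa using hQ0)))
  have hpot : ∀ᶠ s in 𝓝 0, 2 * (X * Q).eval (ξ s ^ 2) = s ^ 2 := by
    filter_upwards [hr, hQpos] with s h1 h2
    nth_rewrite 2 [← h1]
    rw [hSdef, mul_pow, Real.sq_sqrt (by linarith), eval_mul, eval_X]
    ring
  have hcd := hξ.eventually (by simp)
  have hmul : ∀ᶠ s in 𝓝 0, (pullback a g).eval (ξ s) * deriv ξ s = s := by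
    filter_upwards [hpot.eventually_nhds, hcd] with s h1 h2
    have h3 := (h2.differentiableAt two_ne_zero).hasDerivAt
    have h4 := (((X * Q).hasDerivAt (ξ s ^ 2)).comp s (h3.pow 2)).const_mul 2
    have h5 : HasDerivAt (fun s : ℝ => s ^ 2) _ s :=
      h4.congr_of_eventuallyEq (h1.mono fun x hx => hx.symm)
    have h6 := h5.unique (hasDerivAt_pow 2 s)
    rw [hQ] at h6
    simp only [eval_comp, eval_sub, eval_X, eval_C, Nat.cast_ofNat, Nat.add_one_sub_one,
      pow_one] at h6
    rw [eval_pullback]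
    linarith
  have hbd : ∀ᶠ s in 𝓝 0, |ξ s| < 1 := by
    have : Tendsto (fun s => |ξ s|) (𝓝 0) (𝓝 0) := by simpa using hξt.abs
    exact this.eventually (gt_mem_nhds one_pos)
  obtain ⟨R, hR, hball⟩ := Metric.eventually_nhds_iff_ball.1
    (hodd.and (hpos.and (hcd.and (hmul.and hbd))))
  rw [Real.ball_eq_Ioo, zero_sub, zero_add] at hball
  exact ⟨ξ, R, hR, ⟨fun s hs => (hball s hs).2.2.1.contDiffWithinAt, fun s hs => (hball s hs).2.1,
    fun s hs => (hball s hs).2.2.2.1⟩, ⟨1, fun s hs => (hball s hs).2.2.2.2⟩,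
    fun s hs => (hball s hs).1⟩

theorem integral_cos_pow_mul_sin_sq_pos (j : ℕ) :
    0 < ∫ θ in (0 : ℝ)..2 * Real.pi, Real.cos θ ^ (2 * j) * Real.sin θ ^ 2 := by
  have hpi := Real.pi_pos
  refine intervalIntegral.integral_pos (by positivity) (by fun_prop) (fun θ _ => ?_)
    ⟨Real.pi / 4, ⟨by positivity, by linarith⟩, ?_⟩
  · rw [pow_mul]
    positivity
  · rw [Real.cos_pi_div_four, Real.sin_pi_div_four]
    positivity

namespace IsWell

variable {g : ℝ[X]} {ξ : ℝ → ℝ} {R : ℝ}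

/-- The averaged function of the friction `x ↦ e (x / lam)` at amplitude `lam * ρ`, which extends
smoothly to `lam = 0`. -/
noncomputable def scaledMelnikov (e : ℝ[X]) (ξ : ℝ → ℝ) (lam ρ : ℝ) : ℝ :=
  ∫ θ in (0 : ℝ)..2 * Real.pi, e.eval (ρ * Real.cos θ * dslope ξ 0 (lam * ρ * Real.cos θ)) *
    deriv ξ (lam * ρ * Real.cos θ) * Real.sin θ ^ 2

theorem exists_hasDerivAt_scaledMelnikov (h : IsWell g ξ R) (hR : 0 < R) (h0 : ξ 0 = 0)
    (e : ℝ[X]) :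
    ∃ M' : ℝ → ℝ → ℝ, ContinuousOn (Function.uncurry M') {p : ℝ × ℝ | |p.1 * p.2| < R} ∧
      ContinuousOn (Function.uncurry (scaledMelnikov e ξ)) {p : ℝ × ℝ | |p.1 * p.2| < R} ∧
      ∀ p ∈ {p : ℝ × ℝ | |p.1 * p.2| < R},
        HasDerivAt (scaledMelnikov e ξ p.1) (M' p.1 p.2) p.2 := by
  set N : Set (ℝ × ℝ) := {p : ℝ × ℝ | |p.1 * p.2| < R} with hN
  have h0R : (0 : ℝ) ∈ Ioo (-R) R := ⟨by linarith, hR⟩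
  have hmap : MapsTo (fun q : (ℝ × ℝ) × ℝ => q.1.1 * q.1.2 * Real.cos q.2) (N ×ˢ univ)
      (Ioo (-R) R) := fun q hq => mul_cos_mem_Ioo hq.1 _
  have hcomp : ∀ {F : ℝ → ℝ}, ContinuousOn F (Ioo (-R) R) → ContinuousOn
      (fun q : (ℝ × ℝ) × ℝ => F (q.1.1 * q.1.2 * Real.cos q.2)) (N ×ˢ univ) := fun hF =>
    hF.comp (f := fun q : (ℝ × ℝ) × ℝ => q.1.1 * q.1.2 * Real.cos q.2) (by fun_prop) hmap
  have hD := hcomp ((continuousOn_dslope (isOpen_Ioo.mem_nhds h0R)).2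
    ⟨h.contDiffOn.continuousOn, (h.hasDerivAt h0R).differentiableAt⟩)
  have hd₁ := hcomp h.contDiffOn_deriv.continuousOn
  have hd₂ := hcomp h.continuousOn_deriv_deriv
  have hp : ∀ q : ℝ[X], ContinuousOn (fun p : (ℝ × ℝ) × ℝ =>
      q.eval (p.1.2 * Real.cos p.2 * dslope ξ 0 (p.1.1 * p.1.2 * Real.cos p.2))) (N ×ˢ univ) :=
    fun q => q.continuous.comp_continuousOn
      ((Continuous.continuousOn (by fun_prop)).mul hD)
  have hcont₀ : ContinuousOn (Function.uncurry fun (p : ℝ × ℝ) (θ : ℝ) =>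
      e.eval (p.2 * Real.cos θ * dslope ξ 0 (p.1 * p.2 * Real.cos θ)) *
        deriv ξ (p.1 * p.2 * Real.cos θ) * Real.sin θ ^ 2) (N ×ˢ univ) :=
    ((hp e).mul hd₁).mul (Continuous.continuousOn (by fun_prop))
  set F₁ : ℝ × ℝ → ℝ → ℝ := fun p θ =>
    (e.derivative.eval (p.2 * Real.cos θ * dslope ξ 0 (p.1 * p.2 * Real.cos θ)) *
      (Real.cos θ * deriv ξ (p.1 * p.2 * Real.cos θ)) * deriv ξ (p.1 * p.2 * Real.cos θ) +
    e.eval (p.2 * Real.cos θ * dslope ξ 0 (p.1 * p.2 * Real.cos θ)) *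
      (deriv (deriv ξ) (p.1 * p.2 * Real.cos θ) * (p.1 * Real.cos θ))) * Real.sin θ ^ 2
  have hcont₁ : ContinuousOn (Function.uncurry F₁) (N ×ˢ univ) :=
    ((((hp e.derivative).mul ((Continuous.continuousOn (by fun_prop)).mul hd₁)).mul hd₁).add
      ((hp e).mul (hd₂.mul (Continuous.continuousOn (by fun_prop))))).mul
        (Continuous.continuousOn (by fun_prop))
  refine ⟨fun lam ρ => ∫ θ in (0 : ℝ)..2 * Real.pi, F₁ (lam, ρ) θ,
    continuousOn_intervalIntegral hcont₁ 0 (2 * Real.pi),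
    continuousOn_intervalIntegral hcont₀ 0 (2 * Real.pi), ?_⟩
  rintro ⟨lam, ρ⟩ hρ
  have hslice : ∀ {G : ℝ × ℝ → ℝ → ℝ}, ContinuousOn (Function.uncurry G) (N ×ˢ univ) →
      ContinuousOn (Function.uncurry fun ρ θ => G (lam, ρ) θ) ({ρ | |lam * ρ| < R} ×ˢ univ) :=
    fun hG => hG.comp (f := fun p : ℝ × ℝ => ((lam, p.1), p.2)) (by fun_prop)
      fun p hp => ⟨hp.1, mem_univ _⟩
  refine hasDerivAt_intervalIntegral_param (isOpen_lt (by fun_prop) (by fun_prop))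
    (hslice hcont₀) (hslice hcont₁) (fun ρ hρ θ => ?_) 0 (2 * Real.pi) hρ
  have hmem : lam * ρ * Real.cos θ ∈ Ioo (-R) R := mul_cos_mem_Ioo hρ θ
  have hlin : HasDerivAt (fun ρ => lam * ρ * Real.cos θ) (lam * Real.cos θ) ρ := by
    simpa using ((hasDerivAt_id ρ).const_mul lam).mul_const (Real.cos θ)
  have hin : HasDerivAt (fun ρ => ρ * Real.cos θ * dslope ξ 0 (lam * ρ * Real.cos θ))
      (Real.cos θ * deriv ξ (lam * ρ * Real.cos θ)) ρ := by
    rcases eq_or_ne lam 0 with rfl | hlam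
    · simpa using ((hasDerivAt_id ρ).mul_const (Real.cos θ)).mul_const (deriv ξ 0)
    · have hcongr : (fun ρ => ρ * Real.cos θ * dslope ξ 0 (lam * ρ * Real.cos θ)) =
          fun ρ => lam⁻¹ * ξ (lam * ρ * Real.cos θ) := by
        ext ρ
        have := sub_smul_dslope ξ 0 (lam * ρ * Real.cos θ)
        rw [h0, sub_zero, sub_zero, smul_eq_mul] at this
        rw [← this]
        field_simp
      rw [hcongr]
      refine (((h.hasDerivAt hmem).comp ρ hlin).const_mul lam⁻¹).congr_deriv ?_
      field_simp
  exact (((e.hasDerivAt _).comp ρ hin).mul ((h.hasDerivAt_deriv hmem).comp ρ hlin)).mul_const _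

theorem exists_scaledMelnikov_zero_eq (hξ : deriv ξ 0 ≠ 0) (P : ℝ[X]) :
    ∃ e : ℝ[X], e.natDegree ≤ 2 * P.natDegree ∧
      ∀ ρ, scaledMelnikov e ξ 0 ρ = deriv ξ 0 * P.eval (ρ ^ 2) := by
  set c : ℕ → ℝ := fun j =>
    ∫ θ in (0 : ℝ)..2 * Real.pi, Real.cos θ ^ (2 * j) * Real.sin θ ^ 2 with hc
  have hcpos : ∀ j, c j ≠ 0 := fun j => (integral_cos_pow_mul_sin_sq_pos j).ne'
  refine ⟨∑ j ∈ Finset.range (P.natDegree + 1),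
    C (P.coeff j / (deriv ξ 0 ^ (2 * j) * c j)) * X ^ (2 * j), ?_, fun ρ => ?_⟩
  · refine natDegree_sum_le_of_forall_le _ _ fun j hj => (natDegree_C_mul_X_pow_le _ _).trans ?_
    have := Finset.mem_range.1 hj
    omega
  · have : ∀ θ, (∑ j ∈ Finset.range (P.natDegree + 1),
        C (P.coeff j / (deriv ξ 0 ^ (2 * j) * c j)) * X ^ (2 * j)).eval
          (ρ * Real.cos θ * dslope ξ 0 (0 * ρ * Real.cos θ)) *
        deriv ξ (0 * ρ * Real.cos θ) * Real.sin θ ^ 2 = ∑ j ∈ Finset.range (P.natDegree + 1),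
        deriv ξ 0 * (P.coeff j / c j * (ρ ^ 2) ^ j) * (Real.cos θ ^ (2 * j) * Real.sin θ ^ 2) := by
      intro θ
      rw [zero_mul, zero_mul, dslope_same, eval_finsetSum, Finset.sum_mul, Finset.sum_mul]
      refine Finset.sum_congr rfl fun j _ => ?_
      have := hcpos j
      simp only [eval_mul, eval_C, eval_pow, eval_X, mul_pow, pow_mul]
      field_simp
    simp only [scaledMelnikov, this]
    rw [intervalIntegral.integral_finsetSum fun j _ =>
      (Continuous.intervalIntegrable (by fun_prop) _ _), eval_eq_sum_range, Finset.mul_sum]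
    refine Finset.sum_congr rfl fun j _ => ?_
    rw [intervalIntegral.integral_const_mul]
    have := hcpos j
    change _ * c j = _
    field_simp

/-- Even friction can have any number of simple zeros of its average near the bottom of a
well. -/
theorem exists_simple_zeros (h : IsWell g ξ R) (hR : 0 < R) (h0 : ξ 0 = 0) (r : ℕ) :
    ∃ e : ℝ[X], e.natDegree ≤ 2 * r ∧ ∃ Z : Finset ℝ, Z.card = r ∧
      ∀ z ∈ Z, 0 < z ∧ z < R ∧ melnikov e ξ z = 0 ∧
        ∃ c, HasDerivAt (melnikov e ξ) c z ∧ c ≠ 0 := by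
  have hκ : deriv ξ 0 ≠ 0 := (h.deriv_pos 0 ⟨by linarith, hR⟩).ne'
  set v : ℕ → ℝ := fun i => ((i : ℝ) + 1) ^ 2 with hv
  have hvinj : Function.Injective v := fun i j hij => by
    have := (pow_left_inj₀ (by positivity) (by positivity) two_ne_zero).1 hij
    exact_mod_cast add_right_cancel this
  obtain ⟨e, hedeg, he⟩ := exists_scaledMelnikov_zero_eq hκ (Lagrange.nodal (Finset.range r) v)
  rw [Lagrange.natDegree_nodal, Finset.card_range] at hedeg
  obtain ⟨M, hMc, hSc, hM⟩ := h.exists_hasDerivAt_scaledMelnikov hR h0 e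
  have hNo : IsOpen {p : ℝ × ℝ | |p.1 * p.2| < R} := isOpen_lt (by fun_prop) (by fun_prop)
  have hmem0 : ∀ ρ : ℝ, ((0 : ℝ), ρ) ∈ {p : ℝ × ℝ | |p.1 * p.2| < R} := fun ρ => by simpa using hR
  have hM0 : ∀ i ∈ Finset.range r, M 0 (i + 1) ≠ 0 := fun i hi => by
    have h1 := hM _ (hmem0 (i + 1))
    have h2 : HasDerivAt (fun ρ : ℝ => deriv ξ 0 * (Lagrange.nodal (Finset.range r) v).eval (ρ ^ 2))
        _ ((i : ℝ) + 1) :=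
      (((Lagrange.nodal (Finset.range r) v).hasDerivAt _).comp _
        (hasDerivAt_pow 2 ((i : ℝ) + 1))).const_mul (deriv ξ 0)
    rw [← funext he] at h2
    rw [h1.unique h2]
    have h3 := Lagrange.eval_nodal_derivative_eval_node_eq (v := v) hi
    have h4 : (Lagrange.nodal ((Finset.range r).erase i) v).eval (v i) ≠ 0 :=
      Lagrange.eval_nodal_not_at_node fun j hj =>
        hvinj.ne (Finset.ne_of_mem_erase hj).symm
    rw [← h3] at h4
    refine mul_ne_zero hκ (mul_ne_zero h4 ?_)
    positivity
  have hev : ∀ᶠ lam in 𝓝 (0 : ℝ), ∀ i ∈ Finset.range r, ∃ ρ, |ρ - ((i : ℝ) + 1)| < 1 / 3 ∧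
      |lam * ρ| < R ∧ scaledMelnikov e ξ lam ρ = 0 ∧ M lam ρ ≠ 0 := by
    refine (eventually_all_finset _).2 fun i hi => ?_
    refine eventually_exists_simple_zero hNo hSc hMc hM (hmem0 _) ?_ (hM0 i hi) (by norm_num)
    rw [he, show ((i : ℝ) + 1) ^ 2 = v i from rfl, Lagrange.eval_nodal_at_node hi, mul_zero]
  obtain ⟨lam, hlam, hlampos⟩ :=
    ((hev.filter_mono (nhdsWithin_le_nhds (s := Ioi 0))).and self_mem_nhdsWithin).exists
  have hlampos : 0 < lam := hlampos
  choose! ρ hρ using hlam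
  have hscale : ∀ z, melnikov (e.comp (C lam⁻¹ * X)) ξ z = scaledMelnikov e ξ lam (lam⁻¹ * z) := by
    intro z
    unfold melnikov scaledMelnikov
    congr 1
    ext θ
    rw [mul_inv_cancel_left₀ hlampos.ne']
    have := sub_smul_dslope ξ 0 (z * Real.cos θ)
    rw [h0, sub_zero, sub_zero, smul_eq_mul] at this
    simp only [eval_comp, eval_mul, eval_C, eval_X]
    rw [← this]
    ring_nf
  refine ⟨e.comp (C lam⁻¹ * X), ?_, (Finset.range r).image fun i => lam * ρ i, ?_, ?_⟩
  · rw [natDegree_comp, natDegree_C_mul_X _ (inv_ne_zero hlampos.ne'), mul_one]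
    exact hedeg
  · rw [Finset.card_image_of_injOn, Finset.card_range]
    intro i hi j hj hij
    have hij := mul_left_cancel₀ hlampos.ne' hij
    have h1 := abs_lt.1 (hρ i hi).1
    have h2 := abs_lt.1 (hρ j hj).1
    rw [hij] at h1
    have h3 : (i : ℝ) < j + 1 := by linarith
    have h4 : (j : ℝ) < i + 1 := by linarith
    norm_cast at h3 h4
    omega
  · simp only [Finset.mem_image]
    rintro _ ⟨i, hi, rfl⟩
    obtain ⟨h1, h2, h3, h4⟩ := hρ i hi
    have hρpos : 0 < ρ i := by
      have := (abs_lt.1 h1).1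
      have : (0 : ℝ) ≤ i := i.cast_nonneg
      linarith
    refine ⟨by positivity, (le_abs_self _).trans_lt h2, ?_, M lam (ρ i) * lam⁻¹, ?_,
      mul_ne_zero h4 (inv_ne_zero hlampos.ne')⟩
    · rw [hscale, inv_mul_cancel_left₀ hlampos.ne', h3]
    · rw [funext hscale]
      have h5 : HasDerivAt (fun z => lam⁻¹ * z) lam⁻¹ (lam * ρ i) := by
        simpa using (hasDerivAt_id (lam * ρ i)).const_mul lam⁻¹
      have h6 : HasDerivAt (scaledMelnikov e ξ lam) (M lam (ρ i)) (lam⁻¹ * (lam * ρ i)) := by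
        rw [inv_mul_cancel_left₀ hlampos.ne']
        exact hM (lam, ρ i) h2
      exact h6.comp _ h5

end IsWell

/-- `n` data are carried by some friction of degree at most `m` and restoring force of degree at
most `D` which is positive near `-∞` and negative near `+∞`. -/
def HasData (m D n : ℕ) : Prop :=
  ∃ f g : ℝ[X], f.natDegree ≤ m ∧ g.natDegree ≤ D ∧
    (∃ T : Finset (ℝ × ℝ), T.card = n ∧ ∀ q ∈ T, IsDatum f g q.1 q.2) ∧
    ∃ X₀, (∀ x, x ≤ -X₀ → 0 < g.eval x) ∧ ∀ x, X₀ ≤ x → g.eval x < 0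

theorem hasData_zero (m : ℕ) : HasData m 1 0 := by
  refine ⟨0, -X, by simp, by simp, ⟨∅, rfl, by simp⟩, 1, fun x hx => ?_, fun x hx => ?_⟩ <;>
  · simp
    linarith

theorem HasData.hGe {m D n : ℕ} (h : HasData m D n) (hD : D ≤ m) {c : ℝ} (hc : c ≤ n) :
    HGe m m c := by
  obtain ⟨f, g, hf, hg, ⟨T, rfl, hT⟩, -⟩ := h
  exact hGe_of_isDatum hf (hg.trans hD) T hT hc

/-- One doubling: every datum lifts to both sides of the new well, in which `r` new data are
created by an even perturbation of the friction. -/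
theorem HasData.double {m D n m' r : ℕ} (h : HasData m D n) (hm : 2 * m + 1 ≤ m')
    (hr : 2 * r ≤ m') : HasData m' (2 * D + 1) (2 * n + r) := by
  obtain ⟨f, g, hf, hg, ⟨T, rfl, hT⟩, X₀, hneg, hpos⟩ := h
  choose! K hK using fun q hq => (hT q hq).pullback
  obtain ⟨K₀, hK₀⟩ := (T.image K).exists_le
  set a := max K₀ (max X₀ 0) with ha
  have haX : X₀ ≤ a := (le_max_left _ _).trans (le_max_right _ _)
  have ha0 : 0 ≤ a := (le_max_right _ _).trans (le_max_right _ _)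
  have hq : ∀ q ∈ T, _ := fun q hq =>
    hK q hq a ((hK₀ _ (Finset.mem_image_of_mem K hq)).trans (le_max_left _ _))
  obtain ⟨ξ, R, hR, hw, hbd, hodd⟩ := exists_isWell_pullback (hneg (-a) (by linarith))
  have h0R : (0 : ℝ) ∈ Ioo (-R) R := ⟨by linarith, hR⟩
  have hξ0 : ξ 0 = 0 := by
    have := hodd 0 h0R
    rw [neg_zero] at this
    linarith
  obtain ⟨e, hedeg, Z, hZcard, hZ⟩ := hw.exists_simple_zeros hR hξ0 r
  have hmel : ∀ z, |z| < R → melnikov (pullback a f) ξ z = 0 := fun z hz => by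
    have := hw.melnikov_reflect (ξ₂ := ξ) (eval_pullback_neg a f) (fun s hs => ?_) hz
    · linarith
    · rw [hodd s hs, neg_neg]
  set Tp : Finset (ℝ × ℝ) := T.image fun q => (√(q.1 + a), √(q.2 + a)) with hTp
  set Tn : Finset (ℝ × ℝ) := T.image fun q => (-√(q.2 + a), -√(q.1 + a)) with hTn
  set T₀ : Finset (ℝ × ℝ) := Z.image fun z => (ξ (-z), ξ z) with hT₀
  have hsqrt : ∀ {x y : ℝ}, 0 < x + a → 0 < y + a → √(x + a) = √(y + a) → x = y :=
    fun hx hy hxy => add_right_cancel ((Real.sqrt_inj hx.le hy.le).1 hxy)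
  have hTpc : Tp.card = T.card := Finset.card_image_of_injOn fun p hp q hq' hpq =>
    Prod.ext (hsqrt (hq p hp).1 (hq q hq').1 (Prod.ext_iff.1 hpq).1)
      (hsqrt (hq p hp).2.1 (hq q hq').2.1 (Prod.ext_iff.1 hpq).2)
  have hTnc : Tn.card = T.card := Finset.card_image_of_injOn fun p hp q hq' hpq =>
    Prod.ext (hsqrt (hq p hp).1 (hq q hq').1 (neg_injective (Prod.ext_iff.1 hpq).2))
      (hsqrt (hq p hp).2.1 (hq q hq').2.1 (neg_injective (Prod.ext_iff.1 hpq).1))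
  have hmemZ : ∀ z ∈ Z, z ∈ Ioo (-R) R ∧ -z ∈ Ioo (-R) R := fun z hz => by
    have h1 := (hZ z hz).1
    have h2 := (hZ z hz).2.1
    exact ⟨⟨by linarith, h2⟩, by linarith, by linarith⟩
  have hT₀c : T₀.card = r := hZcard ▸ Finset.card_image_of_injOn fun p hp q hq' hpq =>
    hw.strictMonoOn.injOn (hmemZ p hp).1 (hmemZ q hq').1 (Prod.ext_iff.1 hpq).2
  have hev₁ := eventually_exists_isDatum_add_smul (f := pullback a f) (g := pullback a g) Tp
    (by
      simp only [hTp, Finset.mem_image]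
      rintro _ ⟨q, hqT, rfl⟩
      exact (hq q hqT).2.2.1)
    (U := Ioi 0 ×ˢ Ioi 0) (isOpen_Ioi.prod isOpen_Ioi)
    (by
      simp only [hTp, Finset.coe_image]
      rintro _ ⟨q, hqT, rfl⟩
      exact ⟨Real.sqrt_pos.2 (hq q hqT).1, Real.sqrt_pos.2 (hq q hqT).2.1⟩) e
  have hev₂ := eventually_exists_isDatum_add_smul (f := pullback a f) (g := pullback a g) Tn
    (by
      simp only [hTn, Finset.mem_image]
      rintro _ ⟨q, hqT, rfl⟩
      exact (hq q hqT).2.2.2)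
    (U := Iio 0 ×ˢ Iio 0) (isOpen_Iio.prod isOpen_Iio)
    (by
      simp only [hTn, Finset.coe_image]
      rintro _ ⟨q, hqT, rfl⟩
      exact ⟨neg_lt_zero.2 (Real.sqrt_pos.2 (hq q hqT).2.1),
        neg_lt_zero.2 (Real.sqrt_pos.2 (hq q hqT).1)⟩) e
  obtain ⟨δ, ⟨⟨T₁, hT₁c, hT₁⟩, T₂, hT₂c, hT₂⟩, hδ⟩ :=
    (((hev₁.and hev₂).filter_mono (nhdsWithin_le_nhds (s := {0}ᶜ))).and
      self_mem_nhdsWithin).exists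
  have hδ : δ ≠ 0 := hδ
  have hT₀d : ∀ q ∈ T₀, (q.1 < 0 ∧ 0 < q.2) ∧
      IsDatum (pullback a f + C δ * e) (pullback a g) q.1 q.2 := by
    simp only [hT₀, Finset.mem_image]
    rintro _ ⟨z, hz, rfl⟩
    obtain ⟨hz0, hzR, hzm, c, hc, hc0⟩ := hZ z hz
    have hzabs : |z| < R := abs_lt.2 (hmemZ z hz).1
    have hmono := hw.strictMonoOn
    have heq : ∀ x, |x| < R → melnikov (pullback a f + C δ * e) ξ x = δ * melnikov e ξ x :=
      fun x hx => by rw [hw.melnikov_add_smul _ _ _ hx, hmel x hx, zero_add]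
    refine ⟨⟨?_, ?_⟩, ξ, R, z, δ * c, hw, hbd, hz0, hzR, rfl, rfl, ?_, ?_, mul_ne_zero hδ hc0⟩
    · have := hmono (hmemZ z hz).2 h0R (neg_lt_zero.2 hz0)
      rwa [hξ0] at this
    · have := hmono h0R (hmemZ z hz).1 hz0
      rwa [hξ0] at this
    · rw [heq z hzabs, hzm, mul_zero]
    · refine (hc.const_mul δ).congr_of_eventuallyEq ?_
      filter_upwards [isOpen_Ioo.mem_nhds (hmemZ z hz).1] with x hx
      exact heq x (abs_lt.2 hx)
  refine ⟨pullback a f + C δ * e, pullback a g, ?_, ?_, ⟨T₁ ∪ T₂ ∪ T₀, ?_, ?_⟩, a + 1,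
    fun u hu => ?_, fun u hu => ?_⟩
  · refine (natDegree_add_le _ _).trans (max_le ?_ ?_)
    · have := natDegree_pullback_le a f
      omega
    · exact (natDegree_C_mul_le _ _).trans (hedeg.trans hr)
  · have := natDegree_pullback_le a g
    omega
  · rw [Finset.card_union_of_disjoint, Finset.card_union_of_disjoint, hT₁c, hT₂c, hTpc, hTnc, hT₀c]
    · ring
    · refine Finset.disjoint_left.2 fun q h1 h2 =>
        lt_asymm (mem_Ioi.1 (hT₁ q h1).1.1) (mem_Iio.1 (hT₂ q h2).1.1)
    · refine Finset.disjoint_left.2 fun q h1 h2 => ?_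
      rcases Finset.mem_union.1 h1 with h1 | h1
      · exact lt_asymm (mem_Ioi.1 (hT₁ q h1).1.1) (hT₀d q h2).1.1
      · exact lt_asymm (mem_Iio.1 (hT₂ q h1).1.2) (hT₀d q h2).1.2
  · intro q hq'
    simp only [Finset.mem_union] at hq'
    rcases hq' with (h1 | h1) | h1
    · exact (hT₁ q h1).2
    · exact (hT₂ q h1).2
    · exact (hT₀d q h1).2
  · rw [eval_pullback]
    have := hpos (u ^ 2 - a) (by nlinarith)
    exact mul_pos_of_neg_of_neg this (by linarith)
  · rw [eval_pullback]
    have := hpos (u ^ 2 - a) (by nlinarith)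
    exact mul_neg_of_neg_of_pos this (by linarith)

theorem exists_hasData_two_pow_mul_sub_one {k : ℕ} (hk : 1 ≤ k) (p : ℕ) :
    ∃ n, HasData (2 ^ p * k - 1) (2 ^ (p + 1) - 1) n ∧ 2 * (n + 2 ^ p) = p * 2 ^ p * k + 2 := by
  induction p with
  | zero => exact ⟨0, by simpa using hasData_zero _, by simp⟩
  | succ p ih =>
    obtain ⟨n, hn, hcount⟩ := ih
    have h1 : 1 ≤ 2 ^ p * k := Nat.mul_pos (by positivity) hk
    have h2 : 1 ≤ 2 ^ (p + 1) := Nat.one_le_two_pow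
    have h3 : 2 ^ (p + 1) * k = 2 * (2 ^ p * k) := by ring
    have h4 : 2 ^ (p + 1 + 1) = 2 * 2 ^ (p + 1) := by ring
    refine ⟨2 * n + (2 ^ p * k - 1), ?_, ?_⟩
    · have := hn.double (m' := 2 ^ (p + 1) * k - 1) (r := 2 ^ p * k - 1) (by omega) (by omega)
      rwa [show 2 * (2 ^ (p + 1) - 1) + 1 = 2 ^ (p + 1 + 1) - 1 by omega] at this
    · zify [h1] at hcount ⊢
      linear_combination 2 * hcount

theorem exists_hasData_two_pow_mul_sub_two {k : ℕ} (hk : 2 ≤ k) (p : ℕ) :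
    ∃ n, HasData (2 ^ p * k - 2) (2 ^ (p + 1) - 1) n ∧ 2 * (n + 2 ^ p) = p * 2 ^ p * k + 2 := by
  induction p with
  | zero => exact ⟨0, by simpa using hasData_zero _, by simp⟩
  | succ p ih =>
    obtain ⟨n, hn, hcount⟩ := ih
    have h1 : 2 ≤ 2 ^ p * k := hk.trans (Nat.le_mul_of_pos_left _ (by positivity))
    have h1' : 1 ≤ 2 ^ p * k := by omega
    have h2 : 1 ≤ 2 ^ (p + 1) := Nat.one_le_two_pow
    have h3 : 2 ^ (p + 1) * k = 2 * (2 ^ p * k) := by ring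
    have h4 : 2 ^ (p + 1 + 1) = 2 * 2 ^ (p + 1) := by ring
    refine ⟨2 * n + (2 ^ p * k - 1), ?_, ?_⟩
    · have := hn.double (m' := 2 ^ (p + 1) * k - 2) (r := 2 ^ p * k - 1) (by omega) (by omega)
      rwa [show 2 * (2 ^ (p + 1) - 1) + 1 = 2 ^ (p + 1 + 1) - 1 by omega] at this
    · zify [h1'] at hcount ⊢
      linear_combination 2 * hcount

theorem log_bound_le_of_count {k p n : ℕ} (hk : 1 ≤ k)
    (h : 2 * (n + 2 ^ p) = p * 2 ^ p * k + 2) :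
    2 ^ p * (k : ℝ) * Real.log (2 ^ p * k) / (2 * Real.log 2) +
      (-(Real.log k / (2 * Real.log 2)) - 1) * (2 ^ p * k) + 1 ≤ n := by
  have hk' : (1 : ℝ) ≤ k := by exact_mod_cast hk
  have h' : 2 * ((n : ℝ) + 2 ^ p) = p * 2 ^ p * k + 2 := by exact_mod_cast h
  have hlog : Real.log 2 ≠ 0 := (Real.log_pos one_lt_two).ne'
  have hp : (2 : ℝ) ^ p ≤ 2 ^ p * k := le_mul_of_one_le_right (by positivity) hk'
  rw [Real.log_mul (by positivity) (by positivity), Real.log_pow]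
  have : 2 ^ p * (k : ℝ) * (p * Real.log 2 + Real.log k) / (2 * Real.log 2) +
      (-(Real.log k / (2 * Real.log 2)) - 1) * (2 ^ p * k) + 1 =
      p * 2 ^ p * k / 2 - 2 ^ p * k + 1 := by
    field_simp
    ring
  rw [this]
  linarith

theorem tendsto_neg_log_sub_one_div_log (c : ℝ) {l : Filter ℕ} {u v : ℕ → ℝ}
    (hv : Tendsto v l atTop) (huv : Tendsto (fun k => u k / v k) l (𝓝 1)) :
    Tendsto (fun k => (-(u k / c) - 1) / v k) l (𝓝 (-(1 / c))) := by
  have h1 := ((huv.div_const c).neg).sub (tendsto_inv_atTop_zero.comp hv)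
  rw [sub_zero] at h1
  refine h1.congr fun k => ?_
  simp only [Function.comp_apply]
  ring

theorem tendsto_log_succ_div_log :
    Tendsto (fun k : ℕ => Real.log ((k + 1 : ℕ) : ℝ) / Real.log k) atTop (𝓝 1) := by
  have hlog : Tendsto (fun k : ℕ => Real.log k) atTop atTop :=
    Real.tendsto_log_atTop.comp tendsto_natCast_atTop_atTop
  have hdiff : Tendsto (fun k : ℕ => Real.log (1 + 1 / (k : ℝ))) atTop (𝓝 0) := by
    have h1 : Tendsto (fun k : ℕ => 1 + 1 / (k : ℝ)) atTop (𝓝 1) := by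
      simpa using tendsto_one_div_atTop_nhds_zero_nat.const_add (1 : ℝ)
    simpa using h1.log one_ne_zero
  have h2 : Tendsto (fun k : ℕ => 1 + Real.log (1 + 1 / (k : ℝ)) / Real.log k) atTop (𝓝 1) := by
    simpa using (hdiff.div_atTop hlog).const_add 1
  refine h2.congr' ?_
  filter_upwards [hlog.eventually_gt_atTop 0, eventually_gt_atTop 0] with k h0 hk
  have hk' : (0 : ℝ) < k := by exact_mod_cast hk
  rw [show ((k + 1 : ℕ) : ℝ) = k * (1 + 1 / k) by push_cast; field_simp,
    Real.log_mul hk'.ne' (by positivity)]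
  field_simp

end

theorem stmt8 :
    ∃ B Bbar : ℕ → ℝ,
      Tendsto (fun k : ℕ => B k / Real.log k) atTop
        (nhds (-(1 / (2 * Real.log 2)))) ∧
      Tendsto (fun k : ℕ => Bbar k / Real.log k) atTop
        (nhds (-(1 / (2 * Real.log 2)))) ∧
      ∀ k p : ℕ, 2 ≤ k → 1 ≤ p →
        (∀ m : ℕ, m = 2 ^ p * k - 1 →
          HGe m m (((m : ℝ) + 1) * Real.log ((m : ℝ) + 1) / (2 * Real.log 2)
            + B k * ((m : ℝ) + 1) + 1)) ∧
        (∀ m : ℕ, m = 2 ^ p * (k + 1) - 2 →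
          HGe m m (((m : ℝ) + 2) * Real.log ((m : ℝ) + 2) / (2 * Real.log 2)
            + Bbar k * ((m : ℝ) + 2) + 1)) := by
  have hlog : Tendsto (fun k : ℕ => Real.log k) atTop atTop :=
    Real.tendsto_log_atTop.comp tendsto_natCast_atTop_atTop
  refine ⟨fun k => -(Real.log k / (2 * Real.log 2)) - 1,
    fun k => -(Real.log ((k + 1 : ℕ) : ℝ) / (2 * Real.log 2)) - 1,
    tendsto_neg_log_sub_one_div_log _ hlog ?_,
    tendsto_neg_log_sub_one_div_log _ hlog tendsto_log_succ_div_log, fun k p hk _ => ⟨?_, ?_⟩⟩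
  · refine tendsto_const_nhds.congr' ?_
    filter_upwards [hlog.eventually_gt_atTop 0] with k h0
    exact (div_self h0.ne').symm
  · rintro m rfl
    obtain ⟨n, hn, hcount⟩ := exists_hasData_two_pow_mul_sub_one (by omega : 1 ≤ k) p
    have h1 : 2 ^ p * 2 ≤ 2 ^ p * k := Nat.mul_le_mul_left _ hk
    have h2 : 1 ≤ 2 ^ p := Nat.one_le_two_pow
    refine hn.hGe (by rw [pow_succ]; omega) ?_
    have h3 : ((2 ^ p * k - 1 : ℕ) : ℝ) + 1 = 2 ^ p * k := by
      rw [Nat.cast_sub (by omega)]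
      push_cast
      ring
    rw [h3]
    exact log_bound_le_of_count (by omega) hcount
  · rintro m rfl
    obtain ⟨n, hn, hcount⟩ := exists_hasData_two_pow_mul_sub_two (by omega : 2 ≤ k + 1) p
    have h1 : 2 ^ p * 3 ≤ 2 ^ p * (k + 1) := Nat.mul_le_mul_left _ (by omega)
    have h2 : 1 ≤ 2 ^ p := Nat.one_le_two_pow
    refine hn.hGe (by rw [pow_succ]; omega) ?_
    have h3 : ((2 ^ p * (k + 1) - 2 : ℕ) : ℝ) + 2 = 2 ^ p * ((k + 1 : ℕ) : ℝ) := by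
      rw [Nat.cast_sub (by omega)]
      push_cast
      ring
    rw [h3]
    exact log_bound_le_of_count (by omega) hcount
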